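/- arXiv:math/0402030 — 5 statements merged into one kernel-verified Lean document; each statement's English description precedes it below -/
import Mathlib

section
/- Let β > 0 and let y(x) = ∫_0^∞ e^{-xt} e^{-1/t} t^{-(2+β)} dt for x ∈ (0,∞). Then every bounded solution g on (0,∞) of the equation x g''(x) - β g'(x) - g(x) = 0 is a constant multiple of y; in particular the space of bounded solutions of this equation on (0,∞) is one-dimensional. -/
noncomputable section
open MeasureTheory Set Filter
open scoped Topology

/-- The bounded solution `y(x) = ∫_0^∞ e^{-xt} e^{-1/t} t^{-(2+β)} dt` of the equation
`x g'' - β g' - g = 0`. -/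
def zSol (β : ℝ) (x : ℝ) : ℝ :=
  ∫ t in Set.Ioi (0 : ℝ), Real.exp (-x * t) * Real.exp (-1 / t) * t ^ (-(2 + β))

lemma const_of_deriv_zero (f f' : ℝ → ℝ) (hf : ∀ x, 0 < x → HasDerivAt f (f' x) x)
    (h0 : ∀ x, 0 < x → f' x = 0) {x y : ℝ} (hx : 0 < x) (hy : 0 < y) : f x = f y := by
  refine IsOpen.is_const_of_deriv_eq_zero (s := Ioi (0:ℝ)) isOpen_Ioi isPreconnected_Ioi ?_ ?_ hx hy
  · exact fun z hz => (hf z hz).differentiableAt.differentiableWithinAt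
  · intro z hz
    rw [(hf z hz).deriv, h0 z hz]; rfl

lemma mono_of_deriv_nonneg (f f' : ℝ → ℝ) {a : ℝ} (ha : 0 < a)
    (hf : ∀ x, 0 < x → HasDerivAt f (f' x) x)
    (h0 : ∀ x, a ≤ x → 0 ≤ f' x) : MonotoneOn f (Ici a) := by
  refine monotoneOn_of_deriv_nonneg (convex_Ici a) ?_ ?_ ?_
  · exact fun z hz => (hf z (ha.trans_le hz)).continuousAt.continuousWithinAt
  · intro z hz
    rw [interior_Ici] at hz
    exact (hf z (ha.trans hz)).differentiableAt.differentiableWithinAt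
  · intro z hz
    rw [interior_Ici] at hz
    rw [(hf z (ha.trans hz)).deriv]
    exact h0 z (le_of_lt hz)

lemma vanish (β : ℝ) (hβ : 0 < β) (h h1 h2 : ℝ → ℝ)
    (d1 : ∀ x, 0 < x → HasDerivAt h (h1 x) x)
    (d2 : ∀ x, 0 < x → HasDerivAt h1 (h2 x) x)
    (ode : ∀ x, 0 < x → x * h2 x - β * h1 x - h x = 0)
    (C : ℝ) (hC : ∀ x, 1 ≤ x → |h x| ≤ C) (h01 : h 1 = 0) :
    ∀ x, 1 < x → h x = 0 := by
  intro x0 hx0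
  by_contra hne
  set E : ℝ → ℝ := fun x => h x * h1 x * x ^ (-β) with hE
  set E' : ℝ → ℝ := fun x => x ^ (-β - 1) * (x * h1 x ^ 2 + h x ^ 2) with hE'
  have dE : ∀ x, 0 < x → HasDerivAt E (E' x) x := by
    intro x hx
    have a := ((d1 x hx).mul (d2 x hx)).mul (Real.hasDerivAt_rpow_const (p := -β) (Or.inl hx.ne'))
    refine a.congr_deriv ?_
    have e : x ^ (-β) = x ^ (-β - 1) * x := by
      rw [← Real.rpow_add_one hx.ne']; congr 1; ring
    simp only [hE', Pi.mul_apply]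
    rw [e]
    linear_combination (x ^ (-β - 1) * h x) * ode x hx
  have hmono : MonotoneOn E (Ici 1) := by
    refine mono_of_deriv_nonneg E E' one_pos dE ?_
    intro x hx
    have : 0 < x := by linarith
    simp only [hE']; positivity
  have E1 : E 1 = 0 := by simp [hE, h01]
  have Enn : ∀ x, 1 ≤ x → 0 ≤ E x := fun x hx => by
    rw [← E1]; exact hmono self_mem_Ici hx hx
  have hx0' : 0 < x0 := by linarith
  have Epos : 0 < E x0 := by
    rcases (Enn x0 hx0.le).lt_or_eq with hh | hh
    · exact hh
    exfalso
    have hmin : IsLocalMin E x0 := by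
      filter_upwards [lt_mem_nhds hx0] with z hz
      rw [← hh]; exact Enn z hz.le
    have := hmin.hasDerivAt_eq_zero (dE x0 hx0')
    have hp : 0 < E' x0 := by simp only [hE']; positivity
    linarith
  set e := E x0 with he
  have hge : ∀ x, x0 ≤ x → e ≤ h x * h1 x := by
    intro x hx
    have hxp : 0 < x := by linarith
    have a : e ≤ h x * h1 x * x ^ (-β) := hmono hx0.le (hx0.le.trans hx) hx
    have q0 : 0 < x ^ (-β) := Real.rpow_pos_of_pos hxp _
    have q1 : x ^ (-β) ≤ 1 := Real.rpow_le_one_of_one_le_of_nonpos (by linarith) (by linarith)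
    have hp : 0 < h x * h1 x := by
      by_contra hn
      push Not at hn
      nlinarith
    nlinarith
  have hm2 : MonotoneOn (fun x => h x ^ 2 - 2 * e * x) (Ici x0) := by
    refine mono_of_deriv_nonneg _ (fun x => 2 * h x * h1 x - 2 * e) hx0' ?_ ?_
    · intro x hx
      refine (((d1 x hx).pow 2).sub ((hasDerivAt_id x).const_mul (2 * e))).congr_deriv ?_
      simp
    · intro x hx
      have := hge x hx
      nlinarith
  set X := x0 + (C ^ 2 + 1) / (2 * e) with hX
  have hXx : x0 ≤ X := by rw [hX]; have : 0 ≤ (C ^ 2 + 1) / (2 * e) := by positivity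
                          linarith
  have k := hm2 self_mem_Ici hXx hXx
  simp only at k
  have k2 : 2 * e * X = 2 * e * x0 + (C ^ 2 + 1) := by rw [hX]; field_simp
  have k3 := hC X (by linarith)
  have k4 : h X ^ 2 ≤ C ^ 2 := by rw [← sq_abs]; gcongr
  nlinarith [sq_nonneg (h x0)]

lemma proportional (β : ℝ) (hβ : 0 < β) (g g1 g2 y y1 y2 : ℝ → ℝ)
    (d1 : ∀ x, 0 < x → HasDerivAt g (g1 x) x)
    (d2 : ∀ x, 0 < x → HasDerivAt g1 (g2 x) x)
    (ode : ∀ x, 0 < x → x * g2 x - β * g1 x - g x = 0)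
    (e1 : ∀ x, 0 < x → HasDerivAt y (y1 x) x)
    (e2 : ∀ x, 0 < x → HasDerivAt y1 (y2 x) x)
    (ode' : ∀ x, 0 < x → x * y2 x - β * y1 x - y x = 0)
    (ypos : ∀ x, 0 < x → 0 < y x)
    (C : ℝ) (hC : ∀ x, 1 ≤ x → |g x| ≤ C) (D : ℝ) (hD : ∀ x, 1 ≤ x → |y x| ≤ D) :
    ∃ c : ℝ, ∀ x : ℝ, 0 < x → g x = c * y x := by
  set c := g 1 / y 1 with hc
  have hy1 := ypos 1 one_pos
  set h : ℝ → ℝ := fun x => g x - c * y x with hh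
  set h1 : ℝ → ℝ := fun x => g1 x - c * y1 x with hh1
  set h2 : ℝ → ℝ := fun x => g2 x - c * y2 x with hh2
  have f1 : ∀ x, 0 < x → HasDerivAt h (h1 x) x := fun x hx => (d1 x hx).sub ((e1 x hx).const_mul c)
  have f2 : ∀ x, 0 < x → HasDerivAt h1 (h2 x) x := fun x hx => (d2 x hx).sub ((e2 x hx).const_mul c)
  have odeh : ∀ x, 0 < x → x * h2 x - β * h1 x - h x = 0 := fun x hx => by
    simp only [hh, hh1, hh2]
    linear_combination ode x hx - c * ode' x hx
  have h01 : h 1 = 0 := by simp only [hh, hc]; field_simp; ring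
  have hz := vanish β hβ h h1 h2 f1 f2 odeh (C + |c| * D) (fun x hx => by
    simp only [hh]
    refine (abs_sub _ _).trans ?_
    rw [abs_mul]
    have := hC x hx
    have := hD x hx
    gcongr) h01
  have hz2 : h1 2 = 0 := by
    have : HasDerivAt h 0 2 := by
      refine (hasDerivAt_const (2:ℝ) (0:ℝ)).congr_of_eventuallyEq ?_
      filter_upwards [lt_mem_nhds (show (1:ℝ) < 2 by norm_num)] with z hzz using hz z hzz
    exact (f1 2 two_pos).unique this
  have W : ∀ x, 0 < x → h1 x * y x - h x * y1 x = 0 := by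
    intro x hx
    have k := const_of_deriv_zero (fun x => (h1 x * y x - h x * y1 x) * x ^ (-β)) _
      (fun x hx => (((f2 x hx).mul (e1 x hx)).sub ((f1 x hx).mul (e2 x hx))).mul
        (Real.hasDerivAt_rpow_const (p := -β) (Or.inl hx.ne'))) (by
        intro x hx
        have e : x ^ (-β) = x ^ (-β - 1) * x := by
          rw [← Real.rpow_add_one hx.ne']; congr 1; ring
        simp only [Pi.mul_apply, Pi.sub_apply]
        rw [e]
        linear_combination (x ^ (-β - 1)) * (y x * odeh x hx - h x * ode' x hx)) hx two_pos
    simp only [hz2, hz 2 (by norm_num)] at k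
    have q0 : 0 < x ^ (-β) := Real.rpow_pos_of_pos hx _
    simpa [q0.ne'] using k
  refine ⟨c, fun x hx => ?_⟩
  have k := const_of_deriv_zero (fun x => h x / y x) _
      (fun x hx => (f1 x hx).div (e1 x hx) (ypos x hx).ne') (by
        intro x hx
        rw [W x hx, zero_div]) hx one_pos
  simp only [h01, zero_div, div_eq_zero_iff, (ypos x hx).ne', or_false] at k
  simp only [hh] at k
  linarith

/-- kernel -/
def zker (s x t : ℝ) : ℝ := Real.exp (-x * t) * Real.exp (-1 / t) * t ^ s

lemma ker_pos (s x : ℝ) {t : ℝ} (ht : 0 < t) : 0 < zker s x t := by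
  unfold zker; positivity

lemma ker_le (s x : ℝ) (n : ℕ) {t : ℝ} (ht : 0 < t) :
    zker s x t ≤ n.factorial * (t ^ (s + n) * Real.exp (-x * t)) := by
  have a := Real.pow_div_factorial_le_exp (x := 1 / t) (by positivity) n
  have b : Real.exp (-1 / t) ≤ n.factorial * t ^ n := by
    rw [neg_div, Real.exp_neg]
    refine inv_le_of_inv_le₀ (by positivity) (le_trans (le_of_eq ?_) a)
    rw [one_div, inv_pow, mul_inv]
    field_simp
  unfold zker
  rw [Real.rpow_add_natCast ht.ne']
  calc _ ≤ Real.exp (-x * t) * (n.factorial * t ^ n) * t ^ s := by gcongr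
    _ = _ := by ring

lemma ker_meas (s x : ℝ) : Measurable (zker s x) := by
  unfold zker; fun_prop

lemma ker_int (s : ℝ) {x : ℝ} (hx : 0 < x) : IntegrableOn (zker s x) (Ioi 0) := by
  obtain ⟨n, hn⟩ := exists_nat_gt (-1 - s)
  have a := (integrableOn_rpow_mul_exp_neg_mul_rpow (s := s + n) (p := 1) (b := x)
    (by linarith) one_pos hx).const_mul (n.factorial : ℝ)
  refine Integrable.mono' a (ker_meas s x).aestronglyMeasurable ?_
  refine (ae_restrict_iff' measurableSet_Ioi).2 (Eventually.of_forall fun t ht => ?_)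
  rw [Real.norm_of_nonneg (ker_pos s x ht).le]
  simpa using ker_le s x n ht

/-- integral -/
def J (s x : ℝ) : ℝ := ∫ t in Ioi (0:ℝ), zker s x t

lemma ker_mul (s x : ℝ) {t : ℝ} (ht : 0 < t) : t * zker s x t = zker (s + 1) x t := by
  unfold zker; rw [Real.rpow_add_one ht.ne']; ring

lemma J_deriv (s : ℝ) {x : ℝ} (hx : 0 < x) : HasDerivAt (J s) (-J (s + 1) x) x := by
  have key := hasDerivAt_integral_of_dominated_loc_of_deriv_le (μ := volume.restrict (Ioi (0:ℝ)))
    (F := fun x t => zker s x t) (F' := fun x t => -t * zker s x t) (x₀ := x) (s := Ioi (x / 2))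
    (bound := zker (s + 1) (x / 2)) (Ioi_mem_nhds (by linarith))
    (Eventually.of_forall fun z => (ker_meas s z).aestronglyMeasurable) (ker_int s hx)
    ((measurable_neg.mul (ker_meas s x)).aestronglyMeasurable) ?_ (ker_int (s + 1) (by linarith)) ?_
  · refine key.2.congr_deriv ?_
    unfold J
    rw [← integral_neg]
    refine setIntegral_congr_fun measurableSet_Ioi fun t ht => ?_
    simp only [← ker_mul s x ht, neg_mul]
  · refine (ae_restrict_iff' measurableSet_Ioi).2 (Eventually.of_forall fun t ht z hz => ?_)
    have ht' : 0 < t := ht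
    have hz' : x / 2 < z := hz
    rw [neg_mul, norm_neg, ker_mul s z ht, Real.norm_of_nonneg (ker_pos _ _ ht).le]
    unfold zker
    gcongr
  · refine Eventually.of_forall fun t z _ => ?_
    unfold zker
    have a : HasDerivAt (fun z : ℝ => -z * t) (-1 * t) z := ((hasDerivAt_id z).neg).mul_const t
    refine ((a.exp.mul_const _).mul_const _).congr_deriv ?_
    ring

lemma J_pos (s : ℝ) {x : ℝ} (hx : 0 < x) : 0 < J s x := by
  unfold J
  rw [setIntegral_pos_iff_support_of_nonneg_ae _ (ker_int s hx)]
  · have : Function.support (zker s x) ∩ Ioi 0 = Ioi 0 :=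
      inter_eq_right.2 fun t ht => (ker_pos s x ht).ne'
    rw [this]; simp
  · exact (ae_restrict_iff' measurableSet_Ioi).2 (Eventually.of_forall fun t ht => (ker_pos s x ht).le)

lemma ker_deriv (β x : ℝ) {t : ℝ} (ht : 0 < t) :
    HasDerivAt (zker (-β) x) (-x * zker (-β) x t + zker (-(2 + β)) x t - β * zker (-β - 1) x t) t := by
  have a : HasDerivAt (fun t : ℝ => -x * t) (-x * 1) t := (hasDerivAt_id t).const_mul (-x)
  have b : HasDerivAt (fun t : ℝ => -1 / t) (1 / t ^ 2) t := by
    refine ((hasDerivAt_inv ht.ne').const_mul (-1)).congr_deriv ?_ |>.congr_of_eventuallyEq ?_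
    · field_simp
    · exact Eventually.of_forall fun z => by simp [div_eq_mul_inv]
  have c := (a.exp.mul b.exp).mul (Real.hasDerivAt_rpow_const (p := -β) (Or.inl ht.ne'))
  refine c.congr_deriv ?_
  have e : t ^ (-β) = t ^ (-(2 + β)) * t ^ 2 := by
    rw [← Real.rpow_add_natCast ht.ne']; congr 1; push_cast; ring
  simp only [zker, Pi.mul_apply]
  rw [e]
  field_simp
  ring

lemma J_rec (β : ℝ) (hβ : 0 < β) {x : ℝ} (hx : 0 < x) :
    -x * J (-β) x + J (-(2 + β)) x - β * J (-β - 1) x = 0 := by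
  obtain ⟨n, hn⟩ := exists_nat_gt β
  have hp : 0 < -β + n := by linarith
  have k0 : zker (-β) x 0 = 0 := by
    simp [zker, Real.zero_rpow (neg_ne_zero.2 hβ.ne')]
  have b : ∀ t, 0 ≤ t → zker (-β) x t ≤ n.factorial * (t ^ (-β + n) * Real.exp (-x * t)) := by
    intro t ht
    rcases ht.eq_or_lt with rfl | ht
    · rw [k0, Real.zero_rpow hp.ne']; simp
    · exact ker_le _ _ n ht
  have nn : ∀ t, 0 ≤ t → 0 ≤ zker (-β) x t := fun t ht => by unfold zker; positivity
  have i1 := (ker_int (-β) hx).const_mul (-x)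
  have i2 := ker_int (-(2 + β)) hx
  have i3 := (ker_int (-β - 1) hx).const_mul β
  have k := integral_Ioi_of_hasDerivAt_of_tendsto (a := 0) (m := 0) (f := zker (-β) x) ?_
    (fun t ht => ker_deriv β x ht) ((i1.add i2).sub i3) ?_
  · have j1 : IntegrableOn (fun t => -x * zker (-β) x t + zker (-(2 + β)) x t) (Ioi 0) := i1.add i2
    rw [k0, integral_sub j1 i3, integral_add i1 i2, integral_const_mul,
      integral_const_mul] at k
    simpa [J] using k
  · unfold ContinuousWithinAt
    rw [k0]
    have c : ContinuousAt (fun t : ℝ => n.factorial * (t ^ (-β + n) * Real.exp (-x * t))) 0 := by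
      have := Real.continuousAt_rpow_const 0 (-β + n) (Or.inr hp.le)
      fun_prop
    have c' : Tendsto (fun t : ℝ => n.factorial * (t ^ (-β + n) * Real.exp (-x * t)))
        (𝓝[Ici 0] 0) (𝓝 0) := by
      have := c.tendsto.mono_left (nhdsWithin_le_nhds (s := Ici (0:ℝ)))
      simpa [Real.zero_rpow hp.ne'] using this
    refine squeeze_zero' ?_ ?_ c'
    · filter_upwards [self_mem_nhdsWithin] with t ht using nn t ht
    · filter_upwards [self_mem_nhdsWithin] with t ht using b t ht
  · have c' := (tendsto_rpow_mul_exp_neg_mul_atTop_nhds_zero (-β + n) x hx).const_mul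
      (n.factorial : ℝ)
    rw [mul_zero] at c'
    refine squeeze_zero' ?_ ?_ c'
    · filter_upwards [eventually_ge_atTop 0] with t ht using nn t ht
    · filter_upwards [eventually_ge_atTop 0] with t ht using b t ht

/-- Every bounded solution on `(0,∞)` of `x g'' - β g' - g = 0` is a constant
multiple of `y = zSol β`; in particular the space of bounded solutions is one-dimensional. -/
theorem stmt15 (β : ℝ) (hβ : 0 < β)
    (g : ℝ → ℝ)
    (hg : ∀ x : ℝ, 0 < x → DifferentiableAt ℝ g x)
    (hg' : ∀ x : ℝ, 0 < x → DifferentiableAt ℝ (deriv g) x)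
    (hode : ∀ x : ℝ, 0 < x →
      x * deriv (deriv g) x - β * deriv g x - g x = 0)
    (hbdd : ∃ C : ℝ, ∀ x : ℝ, 0 < x → |g x| ≤ C) :
    ∃ c : ℝ, ∀ x : ℝ, 0 < x → g x = c * zSol β x := by
  obtain ⟨C, hC⟩ := hbdd
  have hJ : ∀ x, 1 ≤ x → |J (-(2 + β)) x| ≤ J (-(2 + β)) 1 := by
    intro x hx
    have hx0 : 0 < x := by linarith
    rw [abs_of_pos (J_pos _ hx0)]
    refine setIntegral_mono_on (ker_int _ hx0) (ker_int _ one_pos) measurableSet_Ioi ?_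
    intro t ht
    have ht' : 0 < t := ht
    unfold zker
    gcongr
  exact proportional β hβ g (deriv g) (deriv (deriv g)) (J (-(2 + β)))
    (fun x => -J (-(2 + β) + 1) x) (fun x => J (-(2 + β) + 1 + 1) x)
    (fun x hx => (hg x hx).hasDerivAt) (fun x hx => (hg' x hx).hasDerivAt) hode
    (fun x hx => J_deriv _ hx)
    (fun x hx => (J_deriv (-(2 + β) + 1) hx).neg.congr_deriv (neg_neg _))
    (fun x hx => by
      have := J_rec β hβ hx
      rw [show -(2 + β) + 1 + 1 = -β by ring, show -(2 + β) + 1 = -β - 1 by ring]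
      linarith) (fun x hx => J_pos _ hx) C (fun x hx => hC x (by linarith)) _ hJ
end
end

section
/- Let β > 0, let k = ⌊β⌋ + 1 if β is not an integer and k = β if β is an integer, and let y(x) = ∫_0^∞ e^{-xt} e^{-1/t} t^{-(2+β)} dt be the bounded solution on (0,∞) of x g''(x) - β g'(x) - g(x) = 0. Then for every positive integer N there exist functions a₁ and a₂ of class C^N on [0,∞) with a₁(0) ≠ 0 such that, for all x ∈ (0,1]: if β is an integer, y^{(k+1)}(x) = a₁(x) ln x + a₂(x), and if β is not an integer, y^{(k+1)}(x) = a₁(x) x^{β - k} + a₂(x). -/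
noncomputable section
open MeasureTheory Set Filter
open scoped Topology

/-- parametric Laplace type integral -/
def LapI (μ : Measure ℝ) (h : ℝ → ℝ) (x : ℝ) : ℝ := ∫ t, Real.exp (-x * t) * h t ∂μ

lemma lap_meas {μ : Measure ℝ} {h : ℝ → ℝ} (x : ℝ) (hm : AEStronglyMeasurable h μ) :
    AEStronglyMeasurable (fun t => Real.exp (-x * t) * h t) μ :=
  (by fun_prop : Continuous fun t : ℝ => Real.exp (-x * t)).aestronglyMeasurable.mul hm

lemma lap_int {μ : Measure ℝ} {h : ℝ → ℝ} (hμ : ∀ᵐ t ∂μ, 0 < t) (hi : Integrable h μ) {x : ℝ}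
    (hx : 0 ≤ x) : Integrable (fun t => Real.exp (-x * t) * h t) μ := by
  refine hi.mono (lap_meas x hi.1) ?_
  filter_upwards [hμ] with t ht
  rw [norm_mul, Real.norm_of_nonneg (Real.exp_pos _).le]
  have : Real.exp (-x * t) ≤ 1 := Real.exp_le_one_iff.2 (by nlinarith)
  nlinarith [norm_nonneg (h t)]

lemma lap_hasDerivAt {μ : Measure ℝ} {h : ℝ → ℝ} (hμ : ∀ᵐ t ∂μ, 0 < t)
    (hm : AEStronglyMeasurable h μ)
    (h0 : ∀ x > 0, Integrable (fun t => Real.exp (-x * t) * h t) μ)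
    (h1 : ∀ x > 0, Integrable (fun t => Real.exp (-x * t) * (t * h t)) μ) {x : ℝ} (hx : 0 < x) :
    HasDerivAt (LapI μ h) (-LapI μ (fun t => t * h t) x) x := by
  have key := (hasDerivAt_integral_of_dominated_loc_of_deriv_le (μ := μ) (𝕜 := ℝ)
    (F := fun x t => Real.exp (-x * t) * h t)
    (F' := fun x t => -(Real.exp (-x * t) * (t * h t)))
    (bound := fun t => ‖Real.exp (-(x/2) * t) * (t * h t)‖) (x₀ := x)
    (s := Ioi (x/2)) (Ioi_mem_nhds (by linarith)) ?_ (h0 x hx) ?_ ?_ ?_ ?_).2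
  · rw [integral_neg] at key
    exact key
  · exact Eventually.of_forall fun y => lap_meas y hm
  · exact (h1 x hx).neg.1
  · filter_upwards [hμ] with t ht y hy
    rw [norm_neg]
    simp only [norm_mul]
    refine mul_le_mul_of_nonneg_right ?_ (by positivity)
    rw [Real.norm_of_nonneg (Real.exp_pos _).le, Real.norm_of_nonneg (Real.exp_pos _).le]
    apply Real.exp_le_exp.2
    have : x/2 < y := hy
    nlinarith
  · exact (h1 (x/2) (by linarith)).norm
  · filter_upwards with t y hy
    have : HasDerivAt (fun y : ℝ => Real.exp (-y * t) * h t) (Real.exp (-y * t) * (-1 * t) * h t) y :=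
      ((((hasDerivAt_id y).neg).mul_const t).exp).mul_const (h t)
    exact this.congr_deriv (by ring)

lemma lap_cont {μ : Measure ℝ} {h : ℝ → ℝ} (hμ : ∀ᵐ t ∂μ, 0 < t) (hi : Integrable h μ) :
    ContinuousOn (LapI μ h) (Ici 0) := by
  apply continuousOn_of_dominated (bound := fun t => ‖h t‖)
  · exact fun x _ => lap_meas x hi.1
  · intro x hx
    filter_upwards [hμ] with t ht
    rw [norm_mul, Real.norm_of_nonneg (Real.exp_pos _).le]
    have hx : 0 ≤ x := hx
    have : Real.exp (-x * t) ≤ 1 := Real.exp_le_one_iff.2 (by nlinarith)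
    nlinarith [norm_nonneg (h t)]
  · exact hi.norm
  · filter_upwards with t
    fun_prop

lemma lap_hasDerivWithinAt {μ : Measure ℝ} {h : ℝ → ℝ} (hμ : ∀ᵐ t ∂μ, 0 < t)
    (hi : Integrable h μ) (hi1 : Integrable (fun t => t * h t) μ) {x : ℝ} (hx : 0 ≤ x) :
    HasDerivWithinAt (LapI μ h) (-LapI μ (fun t => t * h t) x) (Ici 0) x := by
  have hd : ∀ y > 0, HasDerivAt (LapI μ h) (-LapI μ (fun t => t * h t) y) y := fun y hy =>
    lap_hasDerivAt hμ hi.1 (fun x hx => lap_int hμ hi hx.le) (fun x hx => lap_int hμ hi1 hx.le) hy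
  rcases hx.eq_or_lt with rfl | hx
  · refine hasDerivWithinAt_Ici_of_tendsto_deriv (s := Ioi 0)
      (fun y hy => (hd y hy).differentiableAt.differentiableWithinAt)
      (((lap_cont hμ hi) 0 self_mem_Ici).mono Ioi_subset_Ici_self) self_mem_nhdsWithin ?_
    have := (((lap_cont hμ hi1) 0 self_mem_Ici).mono Ioi_subset_Ici_self).tendsto.neg
    refine this.congr' ?_
    filter_upwards [self_mem_nhdsWithin] with y hy
    exact (hd y hy).deriv.symm
  · exact (hd x hx).hasDerivWithinAt

lemma contDiffOn_of_hasDeriv {f g : ℝ → ℝ} (n : ℕ)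
    (h : ∀ x, 0 ≤ x → HasDerivWithinAt f (g x) (Ici 0) x) (hg : ContDiffOn ℝ n g (Ici 0)) :
    ContDiffOn ℝ (n + 1 : ℕ) f (Ici 0) := by
  push_cast
  rw [contDiffOn_succ_iff_derivWithin (uniqueDiffOn_Ici 0)]
  refine ⟨fun x hx => (h x hx).differentiableWithinAt, by simp, ?_⟩
  exact hg.congr fun x hx => (h x hx).derivWithin (uniqueDiffOn_Ici 0 x hx)

lemma lap_contDiffOn {μ : Measure ℝ} (hμ : ∀ᵐ t ∂μ, 0 < t) (N : ℕ) : ∀ {h : ℝ → ℝ} 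
    (_ : ∀ n ≤ N, Integrable (fun t => t ^ n * h t) μ), ContDiffOn ℝ N (LapI μ h) (Ici 0) := by
  induction N with
  | zero =>
    intro h hi
    simpa using lap_cont hμ (by simpa using hi 0 le_rfl)
  | succ N ih =>
    intro h hi
    refine contDiffOn_of_hasDeriv N (fun x hx => lap_hasDerivWithinAt hμ (by simpa using hi 0 (by omega))
      (by simpa using hi 1 (by omega)) hx) ?_
    refine (ih fun n hn => ?_).neg
    refine (hi (n+1) (by omega)).congr ?_
    filter_upwards with t
    ring

/-- the integrals `E_j` -/
abbrev EI (p : ℝ) (x : ℝ) : ℝ := LapI (volume.restrict (Ioi 1)) (fun t => t ^ p) x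

lemma ae1 : ∀ᵐ t ∂(volume.restrict (Ioi (1:ℝ))), 0 < t := by
  filter_upwards [ae_restrict_mem measurableSet_Ioi] with t ht
  exact lt_trans one_pos ht

lemma ae01 : ∀ᵐ t ∂(volume.restrict (Ioc (0:ℝ) 1)), 0 < t := by
  filter_upwards [ae_restrict_mem measurableSet_Ioc] with t ht
  exact ht.1

lemma ae0 : ∀ᵐ t ∂(volume.restrict (Ioi (0:ℝ))), 0 < t := by
  filter_upwards [ae_restrict_mem measurableSet_Ioi] with t ht
  exact ht

lemma int_gamma {s x : ℝ} (hs : -1 < s) (hx : 0 < x) :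
    IntegrableOn (fun t : ℝ => Real.exp (-x * t) * t ^ s) (Ioi 0) := by
  have := integrableOn_rpow_mul_exp_neg_mul_rpow hs one_pos hx
  refine this.congr ?_
  filter_upwards with t
  simp [mul_comm]

lemma EI_int (p : ℝ) {x : ℝ} (hx : 0 < x) :
    IntegrableOn (fun t : ℝ => Real.exp (-x * t) * t ^ p) (Ioi 1) := by
  have hg := (int_gamma (s := max p 0) (by have := le_max_right p 0; linarith) hx).mono_set
    (Ioi_subset_Ioi zero_le_one)
  refine Integrable.mono hg (Measurable.aestronglyMeasurable (by fun_prop)) ?_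
  filter_upwards [ae_restrict_mem measurableSet_Ioi] with t ht
  have ht : 1 < t := ht
  rw [norm_mul, norm_mul]
  gcongr
  rw [Real.norm_of_nonneg (by positivity), Real.norm_of_nonneg (by positivity)]
  exact Real.rpow_le_rpow_of_exponent_le ht.le (le_max_left _ _)

lemma EI_rec (p : ℝ) {x : ℝ} (hx : 0 < x) :
    p * EI (p - 1) x = x * EI p x - Real.exp (-x) := by
  have h1 := EI_int p hx
  have h2 := EI_int (p-1) hx
  have key := integral_Ioi_of_hasDerivAt_of_tendsto' (a := 1) (m := 0)
    (f := fun t : ℝ => Real.exp (-x * t) * t ^ p)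
    (f' := fun t : ℝ => p * (Real.exp (-x * t) * t ^ (p-1)) - x * (Real.exp (-x * t) * t ^ p)) ?_ 
    ((h2.const_mul p).sub (h1.const_mul x)) ?_
  · rw [integral_sub (h2.const_mul p) (h1.const_mul x), integral_const_mul, integral_const_mul] at key
    simp only [EI, LapI]
    simp at key ⊢
    linarith
  · intro t ht
    have ht : 1 ≤ t := ht
    have e1 : HasDerivAt (fun t : ℝ => Real.exp (-x * t)) (Real.exp (-x * t) * (-x * 1)) t :=
      ((hasDerivAt_id t).const_mul (-x)).exp
    have e2 := Real.hasDerivAt_rpow_const (x := t) (p := p) (Or.inl (by positivity))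
    exact (e1.mul e2).congr_deriv (by ring)
  · have := tendsto_rpow_mul_exp_neg_mul_atTop_nhds_zero p x hx
    simpa [mul_comm] using this

lemma EI_exp (ν : ℝ) (hν : ν < 1) (N : ℕ) (L : ℝ → ℝ) (c0 : ℝ)
    (hb : ∃ g : ℝ → ℝ, ContDiffOn ℝ N g (Ici 0) ∧ ∀ x > 0, EI (ν - 1) x = c0 * L x + g x) (j : ℕ) :
    ∃ (c : ℝ) (g : ℝ → ℝ), (j = 0 → c = c0) ∧ ContDiffOn ℝ N g (Ici 0) ∧
      ∀ x > 0, EI (ν - 1 - j) x = c * x ^ j * L x + g x := by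
  induction j with
  | zero =>
    obtain ⟨g, hg, h⟩ := hb
    exact ⟨c0, g, fun _ => rfl, hg, by simpa using h⟩
  | succ j ih =>
    obtain ⟨c, g, -, hg, h⟩ := ih
    have hp : ν - 1 - j ≠ 0 := by
      have : (0:ℝ) ≤ j := by positivity
      linarith
    refine ⟨c / (ν - 1 - j), fun x => (x * g x - Real.exp (-x)) / (ν - 1 - j), by simp, ?_, ?_⟩
    · exact ((contDiffOn_id.mul hg).sub (by fun_prop)).div_const _
    · intro x hx
      have := EI_rec (ν - 1 - j) hx
      rw [h x hx] at this
      have e : ν - 1 - ((j+1 : ℕ) : ℝ) = ν - 1 - j - 1 := by push_cast; ring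
      rw [e]
      field_simp
      linear_combination this

lemma base_pos {ν : ℝ} (hν : 0 < ν) (N : ℕ) : 
    ∃ g : ℝ → ℝ, ContDiffOn ℝ N g (Ici 0) ∧
      ∀ x > 0, EI (ν - 1) x = Real.Gamma ν * x ^ (-ν) + g x := by
  have hI : ∀ n : ℕ, Integrable (fun t : ℝ => t ^ n * t ^ (ν - 1)) (volume.restrict (Ioc 0 1)) := by
    intro n
    have : IntegrableOn (fun t : ℝ => t ^ (n + (ν - 1))) (Ioc 0 1) := by
      rw [← intervalIntegrable_iff_integrableOn_Ioc_of_le zero_le_one]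
      apply intervalIntegral.intervalIntegrable_rpow'
      have : (0:ℝ) ≤ n := by positivity
      linarith
    refine this.congr ?_
    filter_upwards [ae01] with t ht
    rw [Real.rpow_add ht, Real.rpow_natCast]
  refine ⟨fun x => - LapI (volume.restrict (Ioc 0 1)) (fun t => t ^ (ν - 1)) x,
    (lap_contDiffOn ae01 N fun n _ => hI n).neg, fun x hx => ?_⟩
  have hg := int_gamma (s := ν - 1) (by linarith) hx
  have h1 := Real.integral_rpow_mul_exp_neg_mul_Ioi hν hx
  have h2 := setIntegral_union (μ := volume) (f := fun t : ℝ => Real.exp (-x * t) * t ^ (ν - 1))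
    (Ioc_disjoint_Ioi_same (a := (0:ℝ)) (b := 1)) measurableSet_Ioi
    (hg.mono_set Ioc_subset_Ioi_self) (hg.mono_set (Ioi_subset_Ioi zero_le_one))
  rw [Ioc_union_Ioi_eq_Ioi zero_le_one] at h2
  have h3 : ∫ t in Ioi (0:ℝ), Real.exp (-x * t) * t ^ (ν - 1) = Real.Gamma ν * x ^ (-ν) := by
    rw [Real.rpow_neg hx.le, ← Real.inv_rpow hx.le, mul_comm, ← one_div, ← h1]
    congr 1
    ext t
    rw [mul_comm, neg_mul]
  rw [h3] at h2
  simp only [EI, LapI]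
  linarith

lemma base_zero (N : ℕ) : 
    ∃ g : ℝ → ℝ, ContDiffOn ℝ N g (Ici 0) ∧
      ∀ x > 0, EI (0 - 1) x = (-1) * Real.log x + g x := by
  have hI : ∀ n : ℕ, Integrable (fun t : ℝ => t ^ n * 1) (volume.restrict (Ioc 0 1)) := by
    intro n
    have : Continuous fun t : ℝ => t ^ n * 1 := by fun_prop
    exact this.integrableOn_Ioc
  set D : ℝ → ℝ := LapI (volume.restrict (Ioc 0 1)) (fun _ => 1) with hD
  have hDs : ∀ N : ℕ, ContDiffOn ℝ N D (Ici 0) := fun N => lap_contDiffOn ae01 N fun n _ => hI n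
  have hDeq : ∀ u, D u = ∫ s in (0:ℝ)..1, Real.exp (-u * s) := by
    intro u
    rw [intervalIntegral.integral_of_le zero_le_one]
    simp [hD, LapI]
  have hDc : Continuous D := by
    rw [funext hDeq]
    apply intervalIntegral.continuous_parametric_intervalIntegral_of_continuous'
    fun_prop
  have hDv : ∀ u > 0, D u = (1 - Real.exp (-u)) / u := by
    intro u hu
    have : ∀ s ∈ uIcc (0:ℝ) 1, HasDerivAt (fun s : ℝ => -Real.exp (-u * s) / u) (Real.exp (-u * s)) s := by
      intro s _
      have := (((hasDerivAt_id s).const_mul (-u)).exp.neg).div_const u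
      exact this.congr_deriv (by simp; field_simp)
    rw [hDeq, intervalIntegral.integral_eq_sub_of_hasDerivAt this
      (Continuous.intervalIntegrable (by fun_prop) _ _)]
    simp
    field_simp
    ring
  have hE : ∀ x > 0, HasDerivAt (EI (0 - 1)) (-(Real.exp (-x) / x)) x := by
    intro x hx
    have e : (fun t : ℝ => t * t ^ (0 - 1 : ℝ)) =ᵐ[volume.restrict (Ioi 1)] fun t => t ^ (0:ℝ) := by
      filter_upwards [ae1] with t ht
      rw [zero_sub, Real.rpow_neg_one, mul_inv_cancel₀ ht.ne', Real.rpow_zero]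
    have := lap_hasDerivAt (h := fun t : ℝ => t ^ (0 - 1 : ℝ)) ae1 (by fun_prop)
      (fun x hx => EI_int _ hx) (fun x hx => (EI_int 0 hx).congr (by
        filter_upwards [e] with t ht; rw [ht])) hx
    convert this using 1
    have h2 : LapI (volume.restrict (Ioi 1)) (fun t : ℝ => t * t ^ (0 - 1 : ℝ)) x = EI 0 x := by
      refine integral_congr_ae ?_
      filter_upwards [e] with t ht; rw [ht]
    rw [h2]
    have := EI_rec 0 hx
    field_simp
    linarith
  set g : ℝ → ℝ := fun x => EI (0-1) 1 + ∫ u in (1:ℝ)..x, D u with hg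
  have hgd : ∀ x, HasDerivAt g (D x) x := fun x =>
    (intervalIntegral.integral_hasDerivAt_right (hDc.intervalIntegrable _ _)
      (hDc.stronglyMeasurableAtFilter _ _) hDc.continuousAt).const_add _
  refine ⟨g, ?_, ?_⟩
  · exact (contDiffOn_of_hasDeriv N (fun x _ => (hgd x).hasDerivWithinAt) (hDs N)).of_le
      (by exact_mod_cast Nat.le_succ N)
  · intro x hx
    have hd : ∀ y ∈ Ioi (0:ℝ), HasDerivAt (fun y => EI (0-1) y + Real.log y - g y) 0 y := by
      intro y hy
      have hy : 0 < y := hy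
      have := ((hE y hy).add (Real.hasDerivAt_log hy.ne')).sub (hgd y)
      exact this.congr_deriv (by rw [hDv y hy]; field_simp; ring)
    have := isOpen_Ioi.is_const_of_deriv_eq_zero (isPreconnected_Ioi)
      (fun y hy => (hd y hy).differentiableAt.differentiableWithinAt) (fun y hy => (hd y hy).deriv)
      (show x ∈ Ioi (0:ℝ) from hx) (show (1:ℝ) ∈ Ioi (0:ℝ) from mem_Ioi.2 one_pos)
    simp [hg] at this ⊢
    linarith

lemma exp_inv_le (m : ℕ) {t : ℝ} (ht : 0 < t) : Real.exp (-1 / t) ≤ m.factorial * t ^ m := by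
  have h := Real.pow_div_factorial_le_exp (1/t) (by positivity) m
  rw [neg_div, Real.exp_neg]
  have hf : (0:ℝ) < m.factorial := by positivity
  rw [inv_le_comm₀ (Real.exp_pos _) (by positivity)]
  refine le_trans (le_of_eq ?_) h
  rw [one_div, inv_pow, mul_inv]
  field_simp

lemma int_full (s : ℝ) {x : ℝ} (hx : 0 < x) :
    IntegrableOn (fun t : ℝ => Real.exp (-x * t) * (Real.exp (-1 / t) * t ^ s)) (Ioi 0) := by
  obtain ⟨m, hm⟩ := exists_nat_gt (-1 - s)
  have hg := (int_gamma (s := m + s) (by linarith) hx).const_mul (m.factorial : ℝ)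
  refine hg.mono (lap_meas x (Measurable.aestronglyMeasurable (by fun_prop))) ?_
  filter_upwards [ae0] with t ht
  rw [Real.norm_of_nonneg (by positivity), Real.norm_of_nonneg (by positivity),
    Real.rpow_add ht, Real.rpow_natCast]
  have := exp_inv_le m ht
  calc _ ≤ Real.exp (-x * t) * ((m.factorial * t ^ m) * t ^ s) := by gcongr
    _ = _ := by ring

/-- the full integral -/
abbrev FI (s : ℝ) (x : ℝ) : ℝ :=
  LapI (volume.restrict (Ioi 0)) (fun t => Real.exp (-1 / t) * t ^ s) x

lemma FI_deriv (s : ℝ) {x : ℝ} (hx : 0 < x) : HasDerivAt (FI s) (-FI (s + 1) x) x := by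
  have e : (fun t : ℝ => t * (Real.exp (-1 / t) * t ^ s)) =ᵐ[volume.restrict (Ioi 0)]
      fun t => Real.exp (-1 / t) * t ^ (s + 1) := by
    filter_upwards [ae0] with t ht
    rw [Real.rpow_add_one ht.ne']; ring
  have := lap_hasDerivAt (h := fun t : ℝ => Real.exp (-1 / t) * t ^ s) ae0
    (Measurable.aestronglyMeasurable (by fun_prop))
    (fun x hx => int_full _ hx) (fun x hx => (int_full (s+1) hx).congr (by
        filter_upwards [e] with t ht; rw [ht])) hx
  convert this using 2
  refine integral_congr_ae ?_
  filter_upwards [e] with t ht; rw [ht]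

lemma zSol_iter (β : ℝ) (n : ℕ) : ∀ x > 0,
    deriv^[n] (zSol β) x = (-1) ^ n * FI (n - (2 + β)) x := by
  induction n with
  | zero =>
    intro x hx
    simp only [zSol, FI, LapI, Function.iterate_zero, id, mul_assoc]
    simp
  | succ n ih =>
    intro x hx
    rw [Function.iterate_succ_apply']
    have : deriv^[n] (zSol β) =ᶠ[𝓝 x] fun x => (-1) ^ n * FI (n - (2 + β)) x := by
      filter_upwards [Ioi_mem_nhds hx] with y hy
      exact ih y hy
    rw [this.deriv_eq, ((FI_deriv _ hx).const_mul _).deriv]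
    have e : (n:ℝ) - (2 + β) + 1 = ((n + 1 : ℕ) : ℝ) - (2 + β) := by push_cast; ring
    rw [e]
    ring

lemma core (ν : ℝ) (hν : ν < 1) (N : ℕ) (L : ℝ → ℝ) (c0 : ℝ)
    (hb : ∃ g : ℝ → ℝ, ContDiffOn ℝ N g (Ici 0) ∧ ∀ x > 0, EI (ν - 1) x = c0 * L x + g x) :
    ∃ a₁ a₂ : ℝ → ℝ, ContDiffOn ℝ N a₁ (Ici 0) ∧ ContDiffOn ℝ N a₂ (Ici 0) ∧ a₁ 0 = c0 ∧
      ∀ x > 0, FI (ν - 1) x = a₁ x * L x + a₂ x := by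
  choose c g hc hg hE using EI_exp ν hν N L c0 hb
  set R : ℝ → ℝ := fun t =>
    (Real.exp (-1 / t) - ∑ j ∈ Finset.range (N + 1), (-1 / t) ^ j / (j.factorial : ℝ)) * t ^ (ν - 1) with hR
  have hRm : Measurable R := by fun_prop
  set h : ℝ → ℝ := fun t => Real.exp (-1 / t) * t ^ (ν - 1) with hh
  have hhm : Measurable h := by fun_prop
  have hI0 : ∀ n ≤ N, Integrable (fun t : ℝ => t ^ n * h t) (volume.restrict (Ioc 0 1)) := by
    intro n _
    have h1 := ((int_full (n + (ν - 1)) one_pos).mono_set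
      (show Ioc (0:ℝ) 1 ⊆ Ioi 0 from fun t ht => ht.1)).const_mul (Real.exp 1)
    refine h1.mono (by fun_prop) ?_
    filter_upwards [ae_restrict_mem measurableSet_Ioc] with t ht
    have ht0 := ht.1
    rw [Real.norm_of_nonneg (by positivity), Real.norm_of_nonneg (by positivity),
      Real.rpow_add ht0, Real.rpow_natCast]
    have : (1:ℝ) ≤ Real.exp (1 + -1 * t) := Real.one_le_exp (by linarith [ht.2])
    have h2 : 0 ≤ t ^ n * h t := by positivity
    calc t ^ n * h t ≤ Real.exp (1 + -1 * t) * (t ^ n * h t) := le_mul_of_one_le_left h2 this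
      _ = _ := by rw [Real.exp_add]; simp only [hh]; ring
  have hIR : ∀ n ≤ N, Integrable (fun t : ℝ => t ^ n * R t) (volume.restrict (Ioi 1)) := by
    intro n hn
    have h1 : IntegrableOn (fun t : ℝ => t ^ (ν - 2)) (Ioi 1) :=
      integrableOn_Ioi_rpow_of_lt (by linarith) one_pos
    have h2 := h1.const_mul (((N+1).succ : ℝ) * (((N+1).factorial : ℝ) * ((N + 1 : ℕ):ℝ))⁻¹)
    refine h2.mono (by fun_prop) ?_
    filter_upwards [ae_restrict_mem measurableSet_Ioi] with t ht
    have ht : 1 < t := ht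
    have ht0 : 0 < t := by linarith
    have hb := Real.exp_bound (x := -1 / t) (by
      rw [abs_div, abs_neg, abs_one, abs_of_pos ht0]; exact (div_le_one ht0).2 ht.le) (Nat.succ_pos N)
    rw [abs_div, abs_neg, abs_one, abs_of_pos ht0] at hb
    have e : t ^ (ν - 1) = t ^ (ν - 2) * t := by
      rw [← Real.rpow_add_one ht0.ne']; congr 1; ring
    have hp : t ^ n ≤ t ^ N := pow_le_pow_right₀ ht.le hn
    set C : ℝ := (((N+1).succ : ℝ) * (((N+1).factorial : ℝ) * ((N + 1 : ℕ):ℝ))⁻¹) with hC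
    have hb' : |Real.exp (-1 / t) - ∑ j ∈ Finset.range (N + 1), (-1 / t) ^ j / (j.factorial : ℝ)| ≤ (1/t)^(N+1) * C := by
      refine hb.trans (le_of_eq ?_)
      simp [hC, div_eq_mul_inv]
    have hC0 : 0 ≤ C := by positivity
    have h3 : ‖C * t ^ (ν - 2)‖ = C * t ^ (ν - 2) := Real.norm_of_nonneg (by positivity)
    have h4 : ‖t ^ n * R t‖ = t ^ n * (|Real.exp (-1 / t) - ∑ j ∈ Finset.range (N + 1), (-1 / t) ^ j / (j.factorial : ℝ)| * t ^ (ν - 1)) := by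
      rw [norm_mul, Real.norm_of_nonneg (by positivity : (0:ℝ) ≤ t ^ n), hR, norm_mul,
        Real.norm_of_nonneg (by positivity : (0:ℝ) ≤ t ^ (ν - 1)), Real.norm_eq_abs]
    rw [h3, h4]
    calc _ ≤ t ^ N * (((1/t)^(N+1) * C) * t ^ (ν - 1)) := by
          refine mul_le_mul hp (mul_le_mul_of_nonneg_right hb' (by positivity)) (by positivity) (by positivity)
      _ = C * t ^ (ν - 2) := by
        rw [e, one_div, inv_pow]; field_simp; ring
  refine ⟨fun x => ∑ j ∈ Finset.range (N+1), (-1) ^ j / (j.factorial : ℝ) * c j * x ^ j,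
    fun x => LapI (volume.restrict (Ioc 0 1)) h x + LapI (volume.restrict (Ioi 1)) R x +
      ∑ j ∈ Finset.range (N+1), (-1) ^ j / (j.factorial : ℝ) * g j x, ?_, ?_, ?_, ?_⟩
  · exact ContDiff.contDiffOn (by fun_prop)
  · refine ((lap_contDiffOn ae01 N hI0).add (lap_contDiffOn ae1 N hIR)).add ?_
    exact ContDiffOn.sum fun j _ => contDiffOn_const.mul (hg j)
  · simp [Finset.sum_range_succ', hc 0 rfl]
  · intro x hx
    have hf := int_full (ν - 1) hx
    have h2 := setIntegral_union (μ := volume) (f := fun t : ℝ => Real.exp (-x * t) * h t)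
      (Ioc_disjoint_Ioi_same (a := (0:ℝ)) (b := 1)) measurableSet_Ioi
      (hf.mono_set Ioc_subset_Ioi_self) (hf.mono_set (Ioi_subset_Ioi zero_le_one))
    rw [Ioc_union_Ioi_eq_Ioi zero_le_one] at h2
    have h3 : ∫ t in Ioi (1:ℝ), Real.exp (-x * t) * h t = LapI (volume.restrict (Ioi 1)) R x +
        ∑ j ∈ Finset.range (N+1), (-1) ^ j / (j.factorial : ℝ) * EI (ν - 1 - j) x := by
      simp only [EI, LapI]
      simp_rw [← integral_const_mul]
      rw [← integral_finsetSum (Finset.range (N+1)) (f := fun (j : ℕ) (t : ℝ) => (-1) ^ j / (j.factorial : ℝ) *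
        (Real.exp (-x * t) * t ^ (ν - 1 - (j:ℝ)))) (fun j _ => (EI_int (ν - 1 - j) hx).const_mul _), ← integral_add
        (lap_int (h := R) ae1 (by simpa using hIR 0 (Nat.zero_le _)) hx.le)
        (integrable_finsetSum (Finset.range (N+1)) (f := fun (j : ℕ) (t : ℝ) => (-1) ^ j / (j.factorial : ℝ) *
          (Real.exp (-x * t) * t ^ (ν - 1 - (j:ℝ)))) fun j _ => (EI_int (ν - 1 - j) hx).const_mul _)]
      refine integral_congr_ae ?_
      filter_upwards [ae1] with t ht
      have : ∀ j : ℕ, (-1) ^ j / (j.factorial : ℝ) * (Real.exp (-x * t) * t ^ (ν - 1 - j)) =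
          Real.exp (-x * t) * t ^ (ν - 1) * ((-1 / t) ^ j / (j.factorial : ℝ)) := by
        intro j
        rw [Real.rpow_sub ht, Real.rpow_natCast, div_pow]
        ring
      simp_rw [this, ← Finset.mul_sum]
      simp only [hh, hR]
      ring
    have h4 : FI (ν - 1) x = ∫ t in Ioi (0:ℝ), Real.exp (-x * t) * h t := rfl
    rw [h4, h2, h3]
    simp_rw [fun j => hE j x hx]
    have h5 : ∫ t in Ioc (0:ℝ) 1, Real.exp (-x * t) * h t = LapI (volume.restrict (Ioc 0 1)) h x := rfl
    rw [h5]
    simp only [mul_add, Finset.sum_add_distrib, Finset.sum_mul]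
    have : ∀ j : ℕ, (-1) ^ j / (j.factorial : ℝ) * (c j * x ^ j * L x) = 
      (-1) ^ j / (j.factorial : ℝ) * c j * x ^ j * L x := fun j => by ring
    simp_rw [this]
    ring

/-- With `k = ⌊β⌋ + 1` if `β` is not an integer and `k = β` otherwise, for
every positive integer `N` there exist `C^N` functions `a₁`, `a₂` on `[0,∞)` with
`a₁(0) ≠ 0` such that on `(0,1]`: `y^{(k+1)}(x) = a₁(x) ln x + a₂(x)` if `β` is an
integer, and `y^{(k+1)}(x) = a₁(x) x^{β-k} + a₂(x)` if `β` is not an integer. -/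
theorem stmt16 (β : ℝ) (hβ : 0 < β)
    (k : ℕ) (hk1 : (∃ m : ℕ, (m : ℝ) = β) → (k : ℝ) = β)
    (hk2 : (¬ ∃ m : ℕ, (m : ℝ) = β) → k = Nat.floor β + 1) :
    ∀ N : ℕ, 0 < N → ∃ a₁ a₂ : ℝ → ℝ,
      ContDiffOn ℝ N a₁ (Set.Ici 0) ∧ ContDiffOn ℝ N a₂ (Set.Ici 0) ∧ a₁ 0 ≠ 0 ∧
      ((∃ m : ℕ, (m : ℝ) = β) →
        ∀ x ∈ Set.Ioc (0 : ℝ) 1,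
          deriv^[k + 1] (zSol β) x = a₁ x * Real.log x + a₂ x) ∧
      ((¬ ∃ m : ℕ, (m : ℝ) = β) →
        ∀ x ∈ Set.Ioc (0 : ℝ) 1,
          deriv^[k + 1] (zSol β) x = a₁ x * x ^ (β - (k : ℝ)) + a₂ x) := by
  intro N _
  have hs : ((k + 1 : ℕ) : ℝ) - (2 + β) = (k - β) - 1 := by push_cast; ring
  by_cases hm : ∃ m : ℕ, (m : ℝ) = β
  · have hk := hk1 hm
    obtain ⟨a₁, a₂, h1, h2, h3, h4⟩ := core 0 one_pos N Real.log (-1) (base_zero N)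
    refine ⟨fun x => (-1) ^ (k+1) * a₁ x, fun x => (-1) ^ (k+1) * a₂ x, contDiffOn_const.mul h1,
      contDiffOn_const.mul h2, by simp [h3], fun _ x hx => ?_, fun h => absurd hm h⟩
    rw [zSol_iter β (k+1) x hx.1, hs, hk, sub_self, h4 x hx.1]
    ring
  · have hk := hk2 hm
    have hlt : β < k := by rw [hk]; push_cast; exact Nat.lt_floor_add_one β
    have hle : (k:ℝ) - β < 1 := by
      have h1 := Nat.floor_le hβ.le
      have h2 : ((⌊β⌋₊ : ℕ) : ℝ) ≠ β := fun h => hm ⟨_, h⟩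
      have := lt_of_le_of_ne h1 h2
      rw [hk]; push_cast; linarith
    obtain ⟨a₁, a₂, h1, h2, h3, h4⟩ := core (k - β) hle N (fun x => x ^ (-((k:ℝ) - β)))
      (Real.Gamma (k - β)) (base_pos (by linarith) N)
    have hG := (Real.Gamma_pos_of_pos (sub_pos.2 hlt)).ne'
    refine ⟨fun x => (-1) ^ (k+1) * a₁ x, fun x => (-1) ^ (k+1) * a₂ x, contDiffOn_const.mul h1,
      contDiffOn_const.mul h2, by simp [h3, hG], fun h => absurd h hm, fun _ x hx => ?_⟩
    rw [zSol_iter β (k+1) x hx.1, hs, h4 x hx.1, neg_sub]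
    ring
end
end

section
/- Let α > 0 and n ≥ 1. The ordinary differential equation a z''(a) - α n z'(a) - z(a) = 0 on (0,∞) has exactly one bounded solution z with lim_{a→0⁺} z(a) = 1. -/
noncomputable section
open MeasureTheory Set Filter
open scoped Topology

def KK (s a t : ℝ) : ℝ := Real.exp (-t) * t ^ s * Real.exp (-(a / t))

def FF (s a : ℝ) : ℝ := ∫ t in Ioi (0:ℝ), KK s a t

lemma KK_meas (s a : ℝ) : AEStronglyMeasurable (KK s a) (volume.restrict (Ioi 0)) := by
  apply Measurable.aestronglyMeasurable
  unfold KK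
  fun_prop

lemma KK_nonneg (s a t : ℝ) (ht : 0 < t) : 0 ≤ KK s a t := by
  unfold KK; positivity

lemma KK_le (s a t : ℝ) (ha : 0 ≤ a) (ht : 0 < t) : KK s a t ≤ Real.exp (-t) * t ^ s := by
  unfold KK
  apply mul_le_of_le_one_right (by positivity)
  apply Real.exp_le_one_iff.2
  have : 0 ≤ a / t := by positivity
  linarith

lemma G_int (s : ℝ) (hs : -1 < s) :
    IntegrableOn (fun t : ℝ => Real.exp (-t) * t ^ s) (Ioi 0) := by
  have := Real.GammaIntegral_convergent (s := s + 1) (by linarith)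
  simpa using this

lemma KK_int (s a : ℝ) (ha : 0 < a) : IntegrableOn (KK s a) (Ioi 0) := by
  obtain ⟨k, hk⟩ := exists_nat_gt (-1 - s)
  have h := (G_int (s + k) (by linarith)).const_mul ((k.factorial : ℝ) / a ^ k)
  refine Integrable.mono' h (KK_meas s a) ?_
  filter_upwards [ae_restrict_mem measurableSet_Ioi] with t ht
  have ht : 0 < t := ht
  rw [Real.norm_of_nonneg (KK_nonneg s a t ht)]
  unfold KK
  rw [Real.rpow_add ht, Real.rpow_natCast]
  have h1 := Real.pow_div_factorial_le_exp (a / t) (by positivity) k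
  have h2 : Real.exp (-(a / t)) ≤ (k.factorial : ℝ) / a ^ k * t ^ k := by
    rw [Real.exp_neg]
    calc (Real.exp (a/t))⁻¹ ≤ ((a/t)^k / (k.factorial : ℝ))⁻¹ := by
          apply inv_anti₀ _ h1
          positivity
      _ = _ := by
          rw [div_pow]; field_simp
  calc _ ≤ Real.exp (-t) * t ^ s * ((k.factorial : ℝ) / a ^ k * t ^ k) := by gcongr
    _ = _ := by ring

lemma FF_deriv (s a : ℝ) (ha : 0 < a) : HasDerivAt (FF s) (-FF (s - 1) a) a := by
  have := (hasDerivAt_integral_of_dominated_loc_of_deriv_le (μ := volume.restrict (Ioi (0:ℝ)))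
    (F := fun a t => KK s a t) (F' := fun a t => - KK (s-1) a t) (x₀ := a) (s := Ioi (a/2))
    (bound := KK (s-1) (a/2)) (Ioi_mem_nhds (by linarith))
    (Eventually.of_forall fun x => KK_meas s x) (KK_int s a ha) (KK_meas (s-1) a).neg ?_
    (KK_int _ _ (by linarith)) ?_).2
  · rw [integral_neg] at this
    exact this
  · filter_upwards [ae_restrict_mem measurableSet_Ioi] with t ht x hx
    have ht : 0 < t := ht
    have hx : a / 2 < x := hx
    rw [norm_neg, Real.norm_of_nonneg (KK_nonneg _ _ t ht)]
    unfold KK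
    gcongr
  · filter_upwards [ae_restrict_mem measurableSet_Ioi] with t ht x hx
    have ht : 0 < t := ht
    unfold KK
    have h := ((((hasDerivAt_id x).div_const t).neg).exp).const_mul (Real.exp (-t) * t ^ s)
    refine HasDerivAt.congr_deriv h ?_
    rw [Real.rpow_sub_one ht.ne']
    simp
    ring

lemma FF_eq (ν a : ℝ) (hν : 0 < ν) (ha : 0 < a) :
    a * FF (ν - 1 - 1) a + ν * FF (ν - 1) a - FF ν a = 0 := by
  have h0 := KK_int ν a ha
  have h1 := (KK_int (ν-1) a ha).const_mul ν
  have h2 := (KK_int (ν-1-1) a ha).const_mul a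
  have key : ∫ t in Ioi (0:ℝ), (a * KK (ν-1-1) a t + ν * KK (ν-1) a t - KK ν a t)
      = 0 - KK ν a 0 := by
    apply integral_Ioi_of_hasDerivAt_of_tendsto (f := KK ν a)
    · have hz : KK ν a 0 = 0 := by simp [KK, Real.zero_rpow hν.ne']
      unfold ContinuousWithinAt
      rw [hz]
      have hlim : Tendsto (fun t : ℝ => t ^ ν) (𝓝[Ici 0] 0) (𝓝 0) := by
        have : ContinuousAt (fun t : ℝ => t ^ ν) 0 :=
          Real.continuousAt_rpow_const _ _ (Or.inr hν.le)
        have h := this.tendsto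
        simp only [Real.zero_rpow hν.ne'] at h
        exact h.mono_left nhdsWithin_le_nhds
      refine squeeze_zero' ?_ ?_ hlim
      · filter_upwards [self_mem_nhdsWithin] with t ht
        have ht : 0 ≤ t := ht
        unfold KK; positivity
      · filter_upwards [self_mem_nhdsWithin] with t ht
        rcases (show 0 ≤ t from ht).eq_or_lt with h | h
        · rw [← h, hz]; positivity
        · refine (KK_le ν a t ha.le h).trans ?_
          apply mul_le_of_le_one_left (by positivity)
          apply Real.exp_le_one_iff.2
          linarith
    · intro t ht
      have ht : 0 < t := ht
      have hd := (((hasDerivAt_id t).neg.exp).mul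
        (Real.hasDerivAt_rpow_const (p := ν) (Or.inl ht.ne'))).mul
        ((((hasDerivAt_inv ht.ne').const_mul a).neg).exp)
      refine HasDerivAt.congr_deriv hd ?_
      unfold KK
      simp only [Real.rpow_sub_one ht.ne', div_eq_mul_inv, id, Pi.mul_apply, Pi.neg_apply]
      field_simp
      ring
    · exact (h2.add h1).sub h0
    · have hlim := tendsto_rpow_mul_exp_neg_mul_atTop_nhds_zero ν 1 one_pos
      refine squeeze_zero' ?_ ?_ hlim
      · filter_upwards [eventually_gt_atTop 0] with t ht using KK_nonneg _ _ _ ht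
      · filter_upwards [eventually_gt_atTop 0] with t ht
        refine (KK_le ν a t ha.le ht).trans (le_of_eq ?_)
        rw [mul_comm]; simp
  have e1 := integral_sub (h2.add h1) h0
  simp only [Pi.add_apply] at e1
  rw [e1, integral_add h2 h1, integral_const_mul, integral_const_mul] at key
  have hz : KK ν a 0 = 0 := by simp [KK, Real.zero_rpow hν.ne']
  rw [hz, sub_zero] at key
  exact key

lemma FF_lim (ν : ℝ) (hν : 0 < ν) :
    Tendsto (FF ν) (𝓝[>] 0) (𝓝 (Real.Gamma (ν + 1))) := by
  rw [Real.Gamma_eq_integral (by linarith)]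
  refine tendsto_integral_filter_of_dominated_convergence
    (fun t : ℝ => Real.exp (-t) * t ^ ν) (Eventually.of_forall fun x => KK_meas ν x) ?_
    (G_int ν (by linarith)) ?_
  · filter_upwards [self_mem_nhdsWithin] with a ha
    filter_upwards [ae_restrict_mem measurableSet_Ioi] with t ht
    rw [Real.norm_of_nonneg (KK_nonneg _ _ t ht)]
    exact KK_le ν a t (le_of_lt ha) ht
  · filter_upwards [ae_restrict_mem measurableSet_Ioi] with t ht
    have : Continuous (fun a => KK ν a t) := by unfold KK; fun_prop
    have h := this.tendsto 0
    have h2 : KK ν 0 t = Real.exp (-t) * t ^ (ν + 1 - 1) := by simp [KK]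
    rw [h2] at h
    exact h.mono_left nhdsWithin_le_nhds

lemma FF_bd (ν a : ℝ) (hν : 0 < ν) (ha : 0 < a) : |FF ν a| ≤ Real.Gamma (ν + 1) := by
  have h0 : 0 ≤ FF ν a := setIntegral_nonneg measurableSet_Ioi fun t ht => KK_nonneg _ _ _ ht
  rw [abs_of_nonneg h0, Real.Gamma_eq_integral (by linarith)]
  simp only [add_sub_cancel_right]
  exact setIntegral_mono_on (KK_int ν a ha) (G_int ν (by linarith)) measurableSet_Ioi
    fun t ht => KK_le ν a t ha.le ht

lemma uniq (ν : ℝ) (w w1 w2 : ℝ → ℝ) (h1 : ∀ a, 0 < a → HasDerivAt w (w1 a) a)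
    (h2 : ∀ a, 0 < a → HasDerivAt w1 (w2 a) a) (hν : 0 < ν)
    (he : ∀ a, 0 < a → a * w2 a - ν * w1 a - w a = 0) (C : ℝ)
    (hC : ∀ a, 0 < a → |w a| ≤ C) (hl : Tendsto w (𝓝[>] 0) (𝓝 0)) :
    ∀ a, 0 < a → w a = 0 := by
  set P : ℝ → ℝ := fun a => w a * w1 a * a ^ (-ν) with hP
  have hPd : ∀ a, 0 < a → HasDerivAt P (a ^ (-ν) / a * (a * w1 a ^ 2 + w a ^ 2)) a := by
    intro a ha
    have h := ((h1 a ha).mul (h2 a ha)).mul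
      (Real.hasDerivAt_rpow_const (p := -ν) (Or.inl ha.ne'))
    refine HasDerivAt.congr_deriv h ?_
    rw [Real.rpow_sub_one ha.ne']
    have e : w2 a = (ν * w1 a + w a) / a := by
      field_simp; linarith [he a ha]
    simp only [Pi.mul_apply, e]
    field_simp
    ring
  have hPm : MonotoneOn P (Ioi 0) := by
    apply monotoneOn_of_deriv_nonneg (convex_Ioi 0)
    · exact fun a ha => (hPd a ha).continuousAt.continuousWithinAt
    · rw [interior_Ioi]
      exact fun a ha => (hPd a ha).differentiableAt.differentiableWithinAt
    · rw [interior_Ioi]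
      intro a ha
      have ha : 0 < a := ha
      rw [(hPd a ha).deriv]; positivity
  have hsq : ∀ a, 0 < a → HasDerivAt (fun a => w a ^ 2) (2 * (w a * w1 a)) a := by
    intro a ha
    refine HasDerivAt.congr_deriv ((h1 a ha).pow 2) ?_
    simp; ring
  have hww : ∀ a, 0 < a → w a * w1 a = P a * a ^ ν := by
    intro a ha
    simp only [hP]
    rw [mul_assoc, ← Real.rpow_add ha]; simp
  have hPn : ∀ a, 0 < a → P a ≤ 0 := by
    intro a ha
    by_contra! hc
    have hpos : 0 < 2 * (P a * a ^ ν) := by positivity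
    have hg := Convex.mul_sub_le_image_sub_of_le_deriv (convex_Ici a) (f := fun a => w a ^ 2)
      (C := 2 * (P a * a ^ ν))
      (fun x hx => (hsq x (lt_of_lt_of_le ha hx)).continuousAt.continuousWithinAt)
      (by
        rw [interior_Ici]
        exact fun x hx => (hsq x (lt_trans ha hx)).differentiableAt.differentiableWithinAt)
      (by
        rw [interior_Ici]
        intro x hx
        have hx : a < x := hx
        have hx0 := ha.trans hx
        rw [(hsq x hx0).deriv, hww x hx0]
        have := hPm (show a ∈ Ioi 0 from ha) (show x ∈ Ioi 0 from hx0) hx.le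
        have hx0' := hc.le.trans this
        gcongr)
    set D := 2 * (P a * a ^ ν)
    have hy : a ≤ a + (C ^ 2 + 1) / D := by
      have : 0 ≤ (C ^ 2 + 1) / D := by positivity
      linarith
    have h3 := hg a self_mem_Ici _ hy hy
    have h4 : D * (a + (C ^ 2 + 1) / D - a) = C ^ 2 + 1 := by field_simp; ring
    rw [h4] at h3
    have h5 := hC _ (ha.trans_le hy)
    have h6 := sq_le_sq' (by linarith [neg_abs_le (w (a + (C ^ 2 + 1) / D))])
      ((le_abs_self _).trans h5)
    nlinarith [sq_nonneg (w a)]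
  have hanti : AntitoneOn (fun a => w a ^ 2) (Ioi 0) := by
    apply antitoneOn_of_deriv_nonpos (convex_Ioi 0)
    · exact fun a ha => (hsq a ha).continuousAt.continuousWithinAt
    · rw [interior_Ioi]
      exact fun a ha => (hsq a ha).differentiableAt.differentiableWithinAt
    · rw [interior_Ioi]
      intro a ha
      have ha : 0 < a := ha
      rw [(hsq a ha).deriv, hww a ha]
      have := mul_nonpos_of_nonpos_of_nonneg (hPn a ha) (Real.rpow_nonneg ha.le ν)
      linarith
  intro a ha
  have hl2 := hl.pow 2
  have h := ge_of_tendsto hl2 (b := w a ^ 2) (by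
    filter_upwards [Ioo_mem_nhdsGT ha] with b hb
    exact hanti hb.1 ha hb.2.le)
  have : w a ^ 2 = 0 := le_antisymm (by simpa using h) (sq_nonneg _)
  exact pow_eq_zero_iff (two_ne_zero) |>.1 this

/-- For `α > 0` and `n ≥ 1`, the equation `a z'' - αn z' - z = 0` on `(0,∞)`
has exactly one bounded solution `z` with `lim_{a→0⁺} z(a) = 1`. -/
theorem stmt17 (α : ℝ) (hα : 0 < α) (n : ℕ) (hn : 1 ≤ n) :
    ∃ z : ℝ → ℝ,
      ((∀ a : ℝ, 0 < a → DifferentiableAt ℝ z a) ∧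
        (∀ a : ℝ, 0 < a → DifferentiableAt ℝ (deriv z) a) ∧
        (∀ a : ℝ, 0 < a →
          a * deriv (deriv z) a - α * (n : ℝ) * deriv z a - z a = 0) ∧
        (∃ C : ℝ, ∀ a : ℝ, 0 < a → |z a| ≤ C) ∧
        Tendsto z (𝓝[>] (0 : ℝ)) (𝓝 1)) ∧
      (∀ z' : ℝ → ℝ,
        ((∀ a : ℝ, 0 < a → DifferentiableAt ℝ z' a) ∧
          (∀ a : ℝ, 0 < a → DifferentiableAt ℝ (deriv z') a) ∧
          (∀ a : ℝ, 0 < a →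
            a * deriv (deriv z') a - α * (n : ℝ) * deriv z' a - z' a = 0) ∧
          (∃ C : ℝ, ∀ a : ℝ, 0 < a → |z' a| ≤ C) ∧
          Tendsto z' (𝓝[>] (0 : ℝ)) (𝓝 1)) →
        ∀ a : ℝ, 0 < a → z' a = z a) := by
  have hν : 0 < α * (n : ℝ) := by
    have : (0:ℝ) < n := by exact_mod_cast hn
    positivity
  generalize α * (n : ℝ) = ν at hν
  have hG : 0 < Real.Gamma (ν + 1) := Real.Gamma_pos_of_pos (by linarith)
  set c := (Real.Gamma (ν + 1))⁻¹ with hc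
  have hd1 : ∀ a, 0 < a → HasDerivAt (fun a => c * FF ν a) (c * -FF (ν-1) a) a :=
    fun a ha => (FF_deriv ν a ha).const_mul c
  have hd2 : ∀ a, 0 < a → HasDerivAt (deriv (fun a => c * FF ν a)) (c * FF (ν-1-1) a) a := by
    intro a ha
    have h := ((FF_deriv (ν-1) a ha).neg).const_mul c
    rw [neg_neg] at h
    refine h.congr_of_eventuallyEq ?_
    filter_upwards [Ioi_mem_nhds ha] with b hb
    exact (hd1 b hb).deriv
  have hb : ∀ a : ℝ, 0 < a → |c * FF ν a| ≤ 1 := by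
    intro a ha
    rw [abs_mul, abs_of_pos (inv_pos.2 hG)]
    calc _ ≤ c * Real.Gamma (ν + 1) := by
          gcongr
          exact FF_bd ν a hν ha
      _ = 1 := inv_mul_cancel₀ hG.ne'
  have hlim : Tendsto (fun a => c * FF ν a) (𝓝[>] (0 : ℝ)) (𝓝 1) := by
    have := (FF_lim ν hν).const_mul c
    rwa [hc, inv_mul_cancel₀ hG.ne'] at this
  have heq : ∀ a : ℝ, 0 < a → a * (c * FF (ν-1-1) a) - ν * (c * -FF (ν-1) a) - c * FF ν a = 0 := by
    intro a ha
    linear_combination c * FF_eq ν a hν ha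
  refine ⟨fun a => c * FF ν a, ⟨fun a ha => (hd1 a ha).differentiableAt,
    fun a ha => (hd2 a ha).differentiableAt, ?_, ⟨1, hb⟩, hlim⟩, ?_⟩
  · intro a ha
    rw [(hd2 a ha).deriv, (hd1 a ha).deriv]
    exact heq a ha
  · rintro y ⟨y1, y2, ye, ⟨C, hC⟩, yl⟩ a ha
    have := uniq ν (fun a => y a - c * FF ν a) (fun a => deriv y a - deriv (fun a => c * FF ν a) a)
      (fun a => deriv (deriv y) a - c * FF (ν-1-1) a)
      (fun a ha => (y1 a ha).hasDerivAt.sub (hd1 a ha).differentiableAt.hasDerivAt)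
      (fun a ha => (y2 a ha).hasDerivAt.sub (hd2 a ha)) hν
      (by
        intro a ha
        rw [(hd1 a ha).deriv]
        linear_combination ye a ha - heq a ha)
      (C + 1) (fun a ha => (abs_sub _ _).trans (add_le_add (hC a ha) (hb a ha)))
      (by simpa using yl.sub hlim) a ha
    exact sub_eq_zero.1 this
end
end

section
/- For every pair of nonnegative integers l and p there exist constants c > 0 and M > 0 such that, for every integer k ≥ 1, ∫_0^∞ t^l |(d/dt)^p L_k(t)|² e^{-t} dt ≤ c k^M, where L_k denotes the k-th Laguerre polynomial. -/
noncomputable section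
open MeasureTheory Set Filter
open scoped Topology

/-- The `k`-th Laguerre polynomial, `L_k(t) = (e^t / k!) (d/dt)^k (e^{-t} t^k)`. -/
def laguerre (k : ℕ) (t : ℝ) : ℝ :=
  Real.exp t / (Nat.factorial k : ℝ) * (deriv^[k] (fun s : ℝ => Real.exp (-s) * s ^ k) t)

open Polynomial in
/-- The operator `D - 1`. -/
def lagE : ℝ[X] →ₗ[ℝ] ℝ[X] := Polynomial.derivative - LinearMap.id

open Polynomial in
/-- Laguerre polynomial. -/
def lagP (k : ℕ) : ℝ[X] := C ((Nat.factorial k : ℝ)⁻¹) * (lagE^[k] (X ^ k))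

/-- The weighted integral. -/
def lagJ (q : Polynomial ℝ) : ℝ := ∫ t in Set.Ioi (0 : ℝ), q.eval t * Real.exp (-t)

open Polynomial

lemma lagE_apply (q : ℝ[X]) : lagE q = derivative q - q := rfl

lemma lag_deriv_exp (k : ℕ) (q : ℝ[X]) :
    deriv^[k] (fun s : ℝ => Real.exp (-s) * q.eval s)
      = fun s => Real.exp (-s) * (lagE^[k] q).eval s := by
  induction k generalizing q with
  | zero => rfl
  | succ k ih =>
    rw [Function.iterate_succ_apply, Function.iterate_succ_apply]
    rw [← ih]
    congr 1
    funext s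
    have h1 : HasDerivAt (fun s : ℝ => Real.exp (-s)) (Real.exp (-s) * (-1)) s :=
      (hasDerivAt_neg s).exp
    have := h1.mul (q.hasDerivAt s)
    refine this.deriv.trans ?_
    rw [lagE_apply, eval_sub]; ring

lemma laguerre_eq (k : ℕ) : laguerre k = fun t => (lagP k).eval t := by
  funext t
  unfold laguerre
  have h := lag_deriv_exp k (X ^ k)
  simp only [eval_pow, eval_X] at h
  rw [h]
  simp only [lagP, eval_mul, eval_C]
  have : Real.exp t * Real.exp (-t) = 1 := by rw [← Real.exp_add]; simp
  calc _ = (Real.exp t * Real.exp (-t)) * ((Nat.factorial k : ℝ)⁻¹ * eval t (lagE^[k] (X ^ k))) := by ring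
    _ = _ := by rw [this, one_mul]

lemma lag_deriv_poly (p : ℕ) (q : ℝ[X]) :
    deriv^[p] (fun s : ℝ => q.eval s) = fun s => (derivative^[p] q).eval s := by
  induction p generalizing q with
  | zero => rfl
  | succ k ih =>
    rw [Function.iterate_succ_apply, Function.iterate_succ_apply, ← ih]
    congr 1
    funext s
    exact q.deriv

lemma lagE_iter_smul (k : ℕ) (a : ℝ) (q : ℝ[X]) :
    lagE^[k] (C a * q) = C a * lagE^[k] q := by
  induction k generalizing q with
  | zero => rfl
  | succ k ih =>
    rw [Function.iterate_succ_apply, Function.iterate_succ_apply, ← ih]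
    congr 1
    rw [lagE_apply, lagE_apply, derivative_C_mul]; ring

lemma lagE_iter_deriv (k : ℕ) (q : ℝ[X]) :
    derivative (lagE^[k] q) = lagE^[k] (derivative q) := by
  induction k generalizing q with
  | zero => rfl
  | succ k ih =>
    rw [Function.iterate_succ_apply, Function.iterate_succ_apply, ih]
    congr 1
    rw [lagE_apply, lagE_apply, derivative_sub]

lemma lagE_iter_X (k : ℕ) (q : ℝ[X]) :
    lagE^[k + 1] (X * q) = X * lagE^[k + 1] q + C ((k : ℝ) + 1) * lagE^[k] q := by
  induction k with
  | zero => simp [lagE_apply]; ring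
  | succ k ih =>
    rw [Function.iterate_succ_apply' _ (k+1), ih, Function.iterate_succ_apply' _ (k+1) q]
    rw [lagE_apply, lagE_apply]
    have : lagE^[k+1] q = derivative (lagE^[k] q) - lagE^[k] q := by
      rw [Function.iterate_succ_apply', lagE_apply]
    simp only [derivative_add, derivative_mul, derivative_X, derivative_C]
    generalize derivative (lagE^[k+1] q) = z at *
    rw [this]
    simp only [map_add, C_1, Nat.cast_add, Nat.cast_one]
    ring

lemma lagP_deriv_succ (k : ℕ) : derivative (lagP (k+1)) = derivative (lagP k) - lagP k := by
  rw [← lagE_apply]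
  unfold lagP
  rw [derivative_C_mul, lagE_iter_deriv, derivative_X_pow, Nat.add_sub_cancel, lagE_iter_smul,
    ← mul_assoc, ← C_mul, Function.iterate_succ_apply']
  have h := lagE_iter_smul 1 ((Nat.factorial k : ℝ)⁻¹) (lagE^[k] (X ^ k))
  simp only [Function.iterate_one] at h
  rw [h]
  congr 2
  rw [Nat.factorial_succ]
  have : (Nat.factorial k : ℝ) ≠ 0 := by positivity
  push_cast
  field_simp

lemma lagP_X_E (k : ℕ) :
    X * (derivative (lagP k) - lagP k) = C ((k:ℝ)+1) * (lagP (k+1) - lagP k) := by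
  rw [← lagE_apply]
  unfold lagP
  have h := lagE_iter_smul 1 ((Nat.factorial k : ℝ)⁻¹) (lagE^[k] (X ^ k))
  simp only [Function.iterate_one] at h
  rw [h, pow_succ', lagE_iter_X, ← Function.iterate_succ_apply' lagE]
  have e : C ((Nat.factorial k : ℝ)⁻¹) = C ((k:ℝ)+1) * C ((Nat.factorial (k+1) : ℝ)⁻¹) := by
    rw [← C_mul]
    congr 1
    rw [Nat.factorial_succ]
    have : (Nat.factorial k : ℝ) ≠ 0 := by positivity
    push_cast
    field_simp
  rw [e]; ring

lemma lagP_zero : lagP 0 = 1 := by simp [lagP]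

lemma lagP_X_D (k : ℕ) :
    X * derivative (lagP k) = C (k:ℝ) * (lagP k - lagP (k-1)) := by
  cases k with
  | zero => simp [lagP_zero]
  | succ k =>
    rw [lagP_deriv_succ, lagP_X_E]; simp

lemma lagP_X (k : ℕ) :
    X * lagP k = C (k:ℝ) * (lagP k - lagP (k-1)) - C ((k:ℝ)+1) * (lagP (k+1) - lagP k) := by
  rw [← lagP_X_D, ← lagP_X_E]; ring

lemma lagP_eval_zero (k : ℕ) : (lagP k).eval 0 = 1 := by
  induction k with
  | zero => simp [lagP_zero]
  | succ k ih =>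
    have h := congrArg (eval 0) (lagP_X_E k)
    simp only [eval_mul, eval_X, zero_mul, eval_C, eval_sub, ih] at h
    have : (k:ℝ)+1 ≠ 0 := by positivity
    have := (mul_eq_zero.1 h.symm).resolve_left this
    linarith

lemma lagP_deriv (k : ℕ) : derivative (lagP k) = - ∑ i ∈ Finset.range k, lagP i := by
  induction k with
  | zero => simp [lagP_zero]
  | succ k ih => rw [lagP_deriv_succ, ih, Finset.sum_range_succ]; ring

lemma lag_integrable (q : ℝ[X]) :
    IntegrableOn (fun t => q.eval t * Real.exp (-t)) (Set.Ioi (0:ℝ)) := by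
  induction q using Polynomial.induction_on' with
  | add p q hp hq =>
    simp only [eval_add, add_mul]
    exact hp.add hq
  | monomial n a =>
    have h := (Real.GammaIntegral_convergent (s := (n:ℝ)+1) (by positivity)).const_mul a
    simp only [add_sub_cancel_right, Real.rpow_natCast] at h
    refine h.congr (Filter.Eventually.of_forall fun t => ?_)
    simp only [eval_monomial]; ring

lemma lagJ_add (p q : ℝ[X]) : lagJ (p + q) = lagJ p + lagJ q := by
  unfold lagJ
  simp only [eval_add, add_mul]
  exact integral_add (lag_integrable p) (lag_integrable q)

lemma lagJ_smul (a : ℝ) (q : ℝ[X]) : lagJ (C a * q) = a * lagJ q := by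
  unfold lagJ
  simp only [eval_mul, eval_C, mul_assoc]
  exact integral_const_mul _ _

lemma lagJ_neg (q : ℝ[X]) : lagJ (-q) = - lagJ q := by
  have := lagJ_smul (-1) q
  simpa using this

lemma lagJ_sum (s : Finset ℕ) (f : ℕ → ℝ[X]) : lagJ (∑ i ∈ s, f i) = ∑ i ∈ s, lagJ (f i) := by
  classical
  induction s using Finset.induction_on with
  | empty => simp [lagJ]
  | insert a s ha ih => rw [Finset.sum_insert ha, Finset.sum_insert ha, lagJ_add, ih]

lemma lagJ_mono (p q : ℝ[X]) (h : ∀ t, 0 < t → p.eval t ≤ q.eval t) : lagJ p ≤ lagJ q := by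
  refine setIntegral_mono_on (lag_integrable p) (lag_integrable q) measurableSet_Ioi ?_
  intro t ht
  exact mul_le_mul_of_nonneg_right (h t ht) (Real.exp_pos _).le

lemma lagJ_deriv (q : ℝ[X]) : lagJ (derivative q) = lagJ q - q.eval 0 := by
  have hd : ∀ x ∈ Set.Ici (0:ℝ), HasDerivAt (fun s : ℝ => q.eval s * Real.exp (-s))
      ((derivative q - q).eval x * Real.exp (-x)) x := by
    intro s _
    have h1 : HasDerivAt (fun s : ℝ => Real.exp (-s)) (Real.exp (-s) * (-1)) s :=
      (hasDerivAt_neg s).exp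
    have := (q.hasDerivAt s).mul h1
    refine this.congr_deriv ?_
    rw [eval_sub]; ring
  have ht : Tendsto (fun s : ℝ => q.eval s * Real.exp (-s)) atTop (𝓝 0) := by
    have := q.tendsto_div_exp_atTop
    simpa [Real.exp_neg, div_eq_mul_inv] using this
  have h := integral_Ioi_of_hasDerivAt_of_tendsto' hd (lag_integrable _) ht
  have h2 : lagJ (derivative q - q) = 0 - q.eval 0 * Real.exp (-0) := h
  rw [sub_eq_add_neg, lagJ_add, lagJ_neg] at h2
  simp at h2
  linarith

lemma lag_rec (k j : ℕ) : lagJ (lagP k * lagP j) =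
    1 - ∑ i ∈ Finset.range k, lagJ (lagP i * lagP j)
      - ∑ i ∈ Finset.range j, lagJ (lagP k * lagP i) := by
  have h := lagJ_deriv (lagP k * lagP j)
  rw [derivative_mul, lagP_deriv, lagP_deriv, eval_mul, lagP_eval_zero, lagP_eval_zero, lagJ_add,
    neg_mul, mul_neg, lagJ_neg, lagJ_neg, Finset.sum_mul, Finset.mul_sum, lagJ_sum, lagJ_sum] at h
  linarith

lemma lag_orth (n : ℕ) : ∀ k j, k + j = n → lagJ (lagP k * lagP j) = if k = j then 1 else 0 := by
  induction n using Nat.strong_induction_on with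
  | _ n ih =>
    intro k j hn
    rw [lag_rec]
    have h1 : ∑ i ∈ Finset.range k, lagJ (lagP i * lagP j)
        = ∑ i ∈ Finset.range k, if i = j then (1:ℝ) else 0 :=
      Finset.sum_congr rfl fun i hi => ih (i + j) (by have := Finset.mem_range.1 hi; omega) i j rfl
    have h2 : ∑ i ∈ Finset.range j, lagJ (lagP k * lagP i)
        = ∑ i ∈ Finset.range j, if k = i then (1:ℝ) else 0 :=
      Finset.sum_congr rfl fun i hi => ih (k + i) (by have := Finset.mem_range.1 hi; omega) k i rfl
    rw [h1, h2, Finset.sum_ite_eq', Finset.sum_ite_eq]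
    simp only [Finset.mem_range]
    rcases lt_trichotomy k j with h | h | h
    · simp [h, h.ne, h.le, not_lt.2 h.le]
    · simp [h]
    · simp [h, h.ne', not_lt.2 h.le]

lemma lag_bound_zero (l : ℕ) : ∃ c : ℝ, 0 ≤ c ∧ ∃ M : ℕ, ∀ k : ℕ,
    lagJ (X ^ (2*l) * lagP k ^ 2) ≤ c * ((k:ℝ)+1) ^ M := by
  induction l with
  | zero =>
    refine ⟨1, zero_le_one, 0, fun k => ?_⟩
    have := lag_orth _ k k rfl
    simp only [if_true] at this
    simp [pow_two, this]
  | succ l ih =>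
    obtain ⟨c, hc, M, h⟩ := ih
    refine ⟨24 * c * 2 ^ M, by positivity, M + 2, fun k => ?_⟩
    have key : lagJ (X ^ (2*(l+1)) * lagP k ^ 2) ≤
        lagJ (C (8 * ((k:ℝ)+1)^2) * (X ^ (2*l) * lagP k ^ 2 + (X ^ (2*l) * lagP (k-1) ^ 2
          + X ^ (2*l) * lagP (k+1) ^ 2))) := by
      apply lagJ_mono
      intro t ht
      have e := congrArg (eval t) (lagP_X k)
      simp only [eval_mul, eval_X, eval_C, eval_sub] at e
      simp only [eval_mul, eval_X, eval_C, eval_add, eval_pow]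
      generalize eval t (lagP k) = a at *
      generalize eval t (lagP (k-1)) = b at *
      generalize eval t (lagP (k+1)) = d at *
      have e2 : t ^ (2*(l+1)) * a^2 = t^(2*l) * (t*a)^2 := by ring
      have hk : (0:ℝ) ≤ k := Nat.cast_nonneg k
      generalize (k:ℝ) = x at *
      have e3 : (t*a)^2 ≤ 8 * (x+1)^2 * (a^2 + b^2 + d^2) := by
        rw [e]
        have i1 : (x * (a-b) - (x+1)*(d-a))^2 ≤ 2 * (x^2*(a-b)^2) + 2 * ((x+1)^2 * (d-a)^2) := by
          nlinarith [sq_nonneg (x * (a-b) + (x+1)*(d-a))]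
        have i2 : x^2*(a-b)^2 ≤ (x+1)^2*(2*a^2+2*b^2) := by
          apply mul_le_mul
          · nlinarith
          · nlinarith [sq_nonneg (a+b)]
          · positivity
          · positivity
        have i3 : (x+1)^2*(d-a)^2 ≤ (x+1)^2*(2*a^2+2*d^2) := by
          apply mul_le_mul_of_nonneg_left _ (by positivity)
          nlinarith [sq_nonneg (a+d)]
        have : 0 ≤ (x+1)^2*b^2 := by positivity
        have : 0 ≤ (x+1)^2*d^2 := by positivity
        nlinarith
      rw [e2]
      have := mul_le_mul_of_nonneg_left e3 (show 0 ≤ t^(2*l) by positivity)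
      nlinarith
    rw [lagJ_smul, lagJ_add, lagJ_add] at key
    have hb : ∀ j ≤ k + 1, lagJ (X ^ (2*l) * lagP j ^ 2) ≤ c * 2^M * ((k:ℝ)+1)^M := by
      intro j hj
      refine (h j).trans ?_
      rw [mul_assoc, ← mul_pow]
      gcongr
      have : (j:ℝ) ≤ k + 1 := by exact_mod_cast hj
      have : (0:ℝ) ≤ k := Nat.cast_nonneg k
      linarith
    refine key.trans ?_
    have h1 := hb k (by omega)
    have h2 := hb (k-1) (by omega)
    have h3 := hb (k+1) le_rfl
    have h4 : lagJ (X ^ (2*l) * lagP k ^ 2) + (lagJ (X ^ (2*l) * lagP (k-1) ^ 2)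
          + lagJ (X ^ (2*l) * lagP (k+1) ^ 2)) ≤ 3 * (c * 2^M * ((k:ℝ)+1)^M) := by linarith
    refine (mul_le_mul_of_nonneg_left h4 (by positivity)).trans (le_of_eq ?_)
    ring

lemma lag_bound (l p : ℕ) : ∃ c : ℝ, 0 ≤ c ∧ ∃ M : ℕ, ∀ k : ℕ,
    lagJ (X ^ (2*l) * (derivative^[p] (lagP k)) ^ 2) ≤ c * ((k:ℝ)+1) ^ M := by
  induction p with
  | zero => exact lag_bound_zero l
  | succ p ih =>
    obtain ⟨c, hc, M, h⟩ := ih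
    refine ⟨c, hc, M + 2, fun k => ?_⟩
    have key : lagJ (X ^ (2*l) * (derivative^[p+1] (lagP k)) ^ 2) ≤
        lagJ (C (k:ℝ) * ∑ i ∈ Finset.range k, X ^ (2*l) * (derivative^[p] (lagP i)) ^ 2) := by
      apply lagJ_mono
      intro t ht
      have e : derivative^[p+1] (lagP k) = - ∑ i ∈ Finset.range k, derivative^[p] (lagP i) := by
        rw [Function.iterate_succ_apply, lagP_deriv, iterate_derivative_neg, iterate_derivative_sum]
      rw [e]
      simp only [eval_mul, eval_X, eval_C, eval_pow, eval_neg, eval_finsetSum, neg_sq]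
      rw [← Finset.mul_sum]
      have := sq_sum_le_card_mul_sum_sq (s := Finset.range k)
        (f := fun i => eval t (derivative^[p] (lagP i)))
      rw [Finset.card_range] at this
      have := mul_le_mul_of_nonneg_left this (show 0 ≤ t^(2*l) by positivity)
      linarith
    refine key.trans ?_
    rw [lagJ_smul, lagJ_sum]
    have hs : ∑ i ∈ Finset.range k, lagJ (X ^ (2*l) * (derivative^[p] (lagP i)) ^ 2)
        ≤ ∑ i ∈ Finset.range k, c * ((k:ℝ)+1)^M := by
      refine Finset.sum_le_sum fun i hi => (h i).trans ?_
      have : (i:ℝ) ≤ k := by exact_mod_cast (Finset.mem_range.1 hi).le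
      gcongr
    rw [Finset.sum_const, Finset.card_range, nsmul_eq_mul] at hs
    have hk : (0:ℝ) ≤ k := Nat.cast_nonneg k
    calc _ ≤ (k:ℝ) * (k * (c * ((k:ℝ)+1)^M)) := mul_le_mul_of_nonneg_left hs hk
      _ ≤ ((k:ℝ)+1) * (((k:ℝ)+1) * (c * ((k:ℝ)+1)^M)) := by gcongr <;> linarith
      _ = _ := by ring

/-- For all nonnegative integers `l`, `p` there exist `c, M > 0` such that for
every `k ≥ 1`, `∫_0^∞ t^l |(d/dt)^p L_k(t)|² e^{-t} dt ≤ c k^M`. -/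
theorem stmt18 (l p : ℕ) :
    ∃ c : ℝ, 0 < c ∧ ∃ M : ℝ, 0 < M ∧
      ∀ k : ℕ, 1 ≤ k →
        ∫ t in Set.Ioi (0 : ℝ),
            t ^ l * |deriv^[p] (laguerre k) t| ^ 2 * Real.exp (-t)
          ≤ c * (k : ℝ) ^ M := by
  obtain ⟨c₁, hc₁, M₁, h₁⟩ := lag_bound 0 p
  obtain ⟨c₂, hc₂, M₂, h₂⟩ := lag_bound l p
  refine ⟨(c₁ + c₂ + 1) * 2 ^ (M₁ + M₂ + 1), by positivity, ((M₁ + M₂ + 1 : ℕ) : ℝ),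
    by positivity, fun k hk => ?_⟩
  rw [Real.rpow_natCast, laguerre_eq, lag_deriv_poly]
  have e : (∫ t in Set.Ioi (0 : ℝ),
      t ^ l * |(derivative^[p] (lagP k)).eval t| ^ 2 * Real.exp (-t))
      = lagJ (X ^ l * (derivative^[p] (lagP k)) ^ 2) := by
    unfold lagJ
    simp only [eval_mul, eval_pow, eval_X, sq_abs]
  rw [e]
  have key : lagJ (X ^ l * (derivative^[p] (lagP k)) ^ 2) ≤
      lagJ (X ^ (2*0) * (derivative^[p] (lagP k)) ^ 2 +
        X ^ (2*l) * (derivative^[p] (lagP k)) ^ 2) := by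
    apply lagJ_mono
    intro t ht
    simp only [eval_mul, eval_pow, eval_X, eval_add]
    rw [← add_mul]
    apply mul_le_mul_of_nonneg_right _ (sq_nonneg _)
    rw [mul_zero, pow_zero, mul_comm 2 l, pow_mul]
    nlinarith [sq_nonneg (t ^ l - 1), pow_pos ht l]
  rw [lagJ_add] at key
  have hk1 : (1:ℝ) ≤ k := by exact_mod_cast hk
  have g1 : c₁ * ((k:ℝ)+1)^M₁ ≤ c₁ * ((k:ℝ)+1)^(M₁+M₂+1) := by
    gcongr
    · linarith
    · omega
  have g2 : c₂ * ((k:ℝ)+1)^M₂ ≤ c₂ * ((k:ℝ)+1)^(M₁+M₂+1) := by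
    gcongr
    · linarith
    · omega
  have g3 : ((k:ℝ)+1)^(M₁+M₂+1) ≤ 2^(M₁+M₂+1) * (k:ℝ)^(M₁+M₂+1) := by
    rw [← mul_pow]
    gcongr
    linarith
  have g4 : 0 ≤ ((k:ℝ)+1)^(M₁+M₂+1) := by positivity
  calc _ ≤ (c₁ + c₂ + 1) * ((k:ℝ)+1)^(M₁+M₂+1) := by
        have := h₁ k
        have := h₂ k
        linarith
    _ ≤ (c₁ + c₂ + 1) * (2^(M₁+M₂+1) * (k:ℝ)^(M₁+M₂+1)) := by gcongr
    _ = _ := by ring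
end
end

section
/- Let n ≥ 1 and ε ∈ (0,1). There exist constants C > 0 and M > 0 such that, for every ψ ∈ C_c^∞(ℝ) with supp ψ ⊂ [ε, ε^{-1}] and every integer κ ≥ 0, the L¹-norm of e_κ^ψ on the Heisenberg group satisfies ∫_{H^n} |e_κ^ψ(w)| dw ≤ C (1+κ)^M (‖ψ‖_∞ + ‖ψ'‖_∞). -/
noncomputable section
open MeasureTheory Filter Set
open scoped Topology BigOperators

/-- The Heisenberg group `H^n = ℂ^n × ℝ` as a set. -/
abbrev Hn (n : ℕ) : Type := (Fin n → ℂ) × ℝ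

/-- The extension `S = H^n × (0,∞)`; we use `H^n × ℝ` and restrict to `a > 0`. -/
abbrev Sg (n : ℕ) : Type := Hn n × ℝ

/-- Directional derivative of a complex valued function in direction `v`. -/
def dirD {E : Type} [NormedAddCommGroup E] [NormedSpace ℝ E]
    (v : E) (f : E → ℂ) (p : E) : ℂ := fderiv ℝ f p v

def eX (n : ℕ) (j : Fin n) : Hn n := (fun i => if i = j then (1 : ℂ) else 0, 0)
def eY (n : ℕ) (j : Fin n) : Hn n := (fun i => if i = j then Complex.I else 0, 0)
def eT (n : ℕ) : Hn n := (0, 1)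

/-- `X_j = ∂_{x_j} + 2 y_j ∂_t` on `H^n`. -/
def XH (n : ℕ) (j : Fin n) (f : Hn n → ℂ) (p : Hn n) : ℂ :=
  dirD (eX n j) f p + 2 * ((p.1 j).im : ℂ) * dirD (eT n) f p

/-- `Y_j = ∂_{y_j} - 2 x_j ∂_t` on `H^n`. -/
def YH (n : ℕ) (j : Fin n) (f : Hn n → ℂ) (p : Hn n) : ℂ :=
  dirD (eY n j) f p - 2 * ((p.1 j).re : ℂ) * dirD (eT n) f p

/-- `T = ∂_t` on `H^n`. -/
def TH (n : ℕ) (f : Hn n → ℂ) (p : Hn n) : ℂ := dirD (eT n) f p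

/-- `ℒ_α = -(1/4) Σ (X_j² + Y_j²) + i α T` on `H^n`. -/
def LH (n : ℕ) (α : ℝ) (f : Hn n → ℂ) (p : Hn n) : ℂ :=
  -(1/4) * ∑ j, (XH n j (XH n j f) p + YH n j (YH n j f) p) + Complex.I * (α : ℂ) * TH n f p

/-- `Z̄_j = (1/2)(X_j + i Y_j)` on `H^n`. -/
def ZbarH (n : ℕ) (j : Fin n) (f : Hn n → ℂ) (p : Hn n) : ℂ :=
  (1/2) * (XH n j f p + Complex.I * YH n j f p)

/-- A function is bounded. -/
def BddFun {X : Type} (f : X → ℂ) : Prop := ∃ C, ∀ p, ‖f p‖ ≤ C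


/-- The normalized Hermite function `h_k(x) = (√π 2^k k!)^{-1/2} (-1)^k e^{x²/2} (d/dx)^k e^{-x²}`. -/
def hermiteFun (k : ℕ) (x : ℝ) : ℝ :=
  (Real.sqrt Real.pi * 2 ^ k * (Nat.factorial k : ℝ)) ^ (-(1/2 : ℝ)) * (-1 : ℝ) ^ k *
    Real.exp (x ^ 2 / 2) * (deriv^[k] (fun y : ℝ => Real.exp (-y ^ 2)) x)

/-- For a multi-index `k`, `h_k = h_{k_1} ⊗ ⋯ ⊗ h_{k_n}`. -/
def hermiteMulti (n : ℕ) (k : Fin n → ℕ) (x : Fin n → ℝ) : ℝ := ∏ j, hermiteFun (k j) (x j)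

/-- The rescaled Hermite function `h_k^λ(x) = (2π|λ|)^{n/4} h_k((2π|λ|)^{1/2} x)`. -/
def hermiteLam (n : ℕ) (lam : ℝ) (k : Fin n → ℕ) (x : Fin n → ℝ) : ℝ :=
  (2 * Real.pi * |lam|) ^ ((n : ℝ) / 4) *
    hermiteMulti n k (fun j => (2 * Real.pi * |lam|) ^ ((1 : ℝ) / 2) * x j)

/-- The representation `R^λ[u+iv,t] Φ(x) = e^{2πiλ(u·x + u·v/2 + t/4)} Φ(x+v)` of `H^n`. -/
def Rrep (n : ℕ) (lam : ℝ) (w : Hn n) (Φ : (Fin n → ℝ) → ℂ) (x : Fin n → ℝ) : ℂ :=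
  Complex.exp (2 * Real.pi * Complex.I * (lam : ℂ) *
      (((∑ j, (w.1 j).re * x j) + (∑ j, (w.1 j).re * (w.1 j).im) / 2 + w.2 / 4 : ℝ) : ℂ)) *
    Φ (fun j => x j + (w.1 j).im)

/-- `e_κ^λ(w) = Σ_{|k|=κ} ⟨R^λ(w) h_k^λ, h_k^λ⟩_{L²(ℝ^n)}`. -/
def eKappaLam (n : ℕ) (κ : ℕ) (lam : ℝ) (w : Hn n) : ℂ :=
  ∑ k ∈ Finset.Nat.antidiagonalTuple n κ,
    ∫ x : Fin n → ℝ,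
      Rrep n lam w (fun x' => ((hermiteLam n lam k x' : ℝ) : ℂ)) x *
        (starRingEnd ℂ) ((hermiteLam n lam k x : ℝ) : ℂ)

/-- `e_κ^ψ(w) = ∫_ℝ e_κ^λ(w) ψ(λ) dλ`. -/
def eKappaPsi (n : ℕ) (κ : ℕ) (ψ : ℝ → ℝ) (w : Hn n) : ℂ :=
  ∫ lam : ℝ, eKappaLam n κ lam w * ((ψ lam : ℝ) : ℂ)

/-- The Heisenberg group product `[ζ,t]·[η,s] = [ζ+η, t+s+2 Im(ζ·conj η)]`. -/
def HeisMul (n : ℕ) (ω w : Hn n) : Hn n :=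
  (ω.1 + w.1, ω.2 + w.2 + 2 * (∑ j, ω.1 j * (starRingEnd ℂ) (w.1 j)).im)
open scoped FourierTransform

lemma auxInt {F : ℝ → ℂ} {a b A : ℝ} (hm : AEStronglyMeasurable F) (hb : ∀ x, ‖F x‖ ≤ A)
    (hs : ∀ x, x ∉ Icc a b → F x = 0) (g : ℝ → ℝ) (hg : Continuous g) :
    Integrable (fun x => g x * ‖F x‖) := by
  have h1 : IntegrableOn (fun x => g x * A) (Icc a b) :=
    (hg.mul continuous_const).continuousOn.integrableOn_compact isCompact_Icc
  have h2 : Integrable ((Icc a b).indicator (fun x => g x * A)) :=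
    (integrable_indicator_iff measurableSet_Icc).2 h1
  refine h2.mono (hg.aestronglyMeasurable.mul hm.norm) (Eventually.of_forall fun x => ?_)
  by_cases hx : x ∈ Icc a b
  · rw [indicator_of_mem hx, norm_mul, norm_mul, norm_norm]
    gcongr
    exact (hb x).trans (le_abs_self A)
  · simp [hs x hx]

lemma auxIntF {F : ℝ → ℂ} {a b A : ℝ} (hm : AEStronglyMeasurable F) (hb : ∀ x, ‖F x‖ ≤ A)
    (hs : ∀ x, x ∉ Icc a b → F x = 0) : Integrable F := by
  have := auxInt hm hb hs (fun _ => 1) continuous_const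
  simp only [one_mul] at this
  exact (integrable_norm_iff hm).1 this

lemma auxSq {F : ℝ → ℂ} {a b A : ℝ} (hab : a ≤ b) (hm : AEStronglyMeasurable F) (hb : ∀ x, ‖F x‖ ≤ A)
    (hs : ∀ x, x ∉ Icc a b → F x = 0) :
    Integrable (fun x => ‖F x‖ ^ 2) ∧ ∫ x, ‖F x‖ ^ 2 ≤ A ^ 2 * (b - a) := by
  have h2 : Integrable ((Icc a b).indicator (fun _ => A ^ 2)) :=
    (integrable_indicator_iff measurableSet_Icc).2 (by simp)
  have h3 : ∀ x, ‖F x‖ ^ 2 ≤ (Icc a b).indicator (fun _ => A ^ 2) x := by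
    intro x
    by_cases hx : x ∈ Icc a b
    · rw [indicator_of_mem hx]
      gcongr
      exact hb x
    · simp [hs x hx, hx]
  have h4 : Integrable (fun x => ‖F x‖ ^ 2) := by
    refine h2.mono' (hm.norm.pow 2) (Eventually.of_forall fun x => ?_)
    simpa using h3 x
  refine ⟨h4, (integral_mono h4 h2 h3).trans ?_⟩
  rw [integral_indicator measurableSet_Icc]
  simp [hab, mul_comm]

lemma auxPlan {F : ℝ → ℂ} {a b A : ℝ} (hab : a ≤ b) (hm : AEStronglyMeasurable F)
    (hb : ∀ x, ‖F x‖ ≤ A)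
    (hs : ∀ x, x ∉ Icc a b → F x = 0) (R : ℝ) (hR : 0 < R) :
    ∫ ξ in (-R)..R, ‖𝓕 F ξ‖ ^ 2 ≤ A ^ 2 * (b - a) := by
  obtain ⟨hF2, hF2'⟩ := auxSq hab hm hb hs
  have hFi := auxIntF hm hb hs
  have hsm : ContDiff ℝ (⊤ : ℕ∞) (𝓕 F) := by
    apply Real.contDiff_fourier
    intro n _
    exact auxInt hm hb hs (fun v => ‖v‖ ^ n) (by fun_prop)
  let χ : ContDiffBump (0 : ℝ) := ⟨R, R + 1, hR, by linarith⟩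
  have hχs : ContDiff ℝ (⊤ : ℕ∞) χ := χ.contDiff
  have hχc : HasCompactSupport χ := χ.hasCompactSupport
  set φ : ℝ → ℂ := fun ξ => (χ ξ : ℂ) * (starRingEnd ℂ) (𝓕 F ξ) with hφ
  have hφs : ContDiff ℝ (⊤ : ℕ∞) φ := by
    refine (Complex.ofRealCLM.contDiff.comp hχs).mul ?_
    exact Complex.conjCLE.contDiff.comp hsm
  have hφc : HasCompactSupport φ := by
    refine HasCompactSupport.mul_right ?_
    exact hχc.comp_left (g := fun x : ℝ => (x : ℂ)) (by simp)
  let Φ : SchwartzMap ℝ ℂ := hφc.toSchwartzMap hφs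
  have hΦ : (Φ : ℝ → ℂ) = φ := rfl
  have hpl := SchwartzMap.integral_norm_sq_fourier Φ
  have hfl : ∫ ξ, 𝓕 F ξ * φ ξ = ∫ x, F x * 𝓕 φ x := by
    have := VectorFourier.integral_fourierIntegral_smul_eq_flip (L := innerₗ ℝ) (μ := volume)
      (ν := volume) Real.continuous_fourierChar continuous_inner hFi Φ.integrable
    simpa [hΦ] using! this
  have hFΦ2 : Integrable (fun x => ‖𝓕 φ x‖ ^ 2) := by
    have := (𝓕 Φ).memLp 2 volume
    exact this.integrable_norm_pow (by norm_num)
  have hc : Continuous (𝓕 F) := hsm.continuous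
  have hI : Integrable (fun ξ => χ ξ * ‖𝓕 F ξ‖ ^ 2) :=
    (χ.continuous.mul (hc.norm.pow 2)).integrable_of_hasCompactSupport hχc.mul_right
  have hl : ∫ ξ, 𝓕 F ξ * φ ξ = ((∫ ξ, χ ξ * ‖𝓕 F ξ‖ ^ 2 : ℝ) : ℂ) := by
    rw [← integral_complex_ofReal]
    congr 1; ext ξ
    simp only [hφ]
    rw [mul_left_comm, Complex.mul_conj, Complex.normSq_eq_norm_sq]
    push_cast; ring
  have h1 : ∫ ξ, χ ξ * ‖𝓕 F ξ‖ ^ 2 ≤ ∫ x, (‖F x‖ ^ 2 / 2 + ‖𝓕 φ x‖ ^ 2 / 2) := by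
    calc ∫ ξ, χ ξ * ‖𝓕 F ξ‖ ^ 2 ≤ ‖∫ ξ, 𝓕 F ξ * φ ξ‖ := by
          rw [hl, Complex.norm_real]; exact le_abs_self _
      _ ≤ _ := by
          rw [hfl]
          refine norm_integral_le_of_norm_le ((hF2.div_const 2).add (hFΦ2.div_const 2))
            (Eventually.of_forall fun x => ?_)
          rw [norm_mul]
          nlinarith [sq_nonneg (‖F x‖ - ‖𝓕 φ x‖)]
  rw [integral_add (hF2.div_const 2) (hFΦ2.div_const 2), integral_div, integral_div] at h1
  have h2 : ∫ x, ‖𝓕 φ x‖ ^ 2 ≤ ∫ ξ, χ ξ * ‖𝓕 F ξ‖ ^ 2 := by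
    have : ∫ x, ‖𝓕 φ x‖ ^ 2 = ∫ x, ‖φ x‖ ^ 2 := hpl
    rw [this]
    refine integral_mono_of_nonneg (Eventually.of_forall fun x => by positivity) hI
      (Eventually.of_forall fun x => ?_)
    simp only [hφ, norm_mul, mul_pow, Complex.norm_real, RCLike.norm_conj]
    gcongr
    rw [Real.norm_of_nonneg χ.nonneg]
    nlinarith [χ.nonneg (x := x), χ.le_one (x := x)]
  have h3 : ∫ ξ in (-R)..R, ‖𝓕 F ξ‖ ^ 2 ≤ ∫ ξ, χ ξ * ‖𝓕 F ξ‖ ^ 2 := by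
    rw [intervalIntegral.integral_of_le (by linarith)]
    refine le_trans (le_of_eq ?_) (setIntegral_le_integral (s := Ioc (-R) R) hI
      (Eventually.of_forall fun x => mul_nonneg χ.nonneg (by positivity)))
    refine setIntegral_congr_fun measurableSet_Ioc fun x hx => ?_
    have : χ x = 1 := χ.one_of_mem_closedBall (by
      rw [Metric.mem_closedBall, dist_zero_right, Real.norm_eq_abs, abs_le]
      exact ⟨hx.1.le, hx.2⟩)
    simp [this]
  linarith

lemma auxL1 {F : ℝ → ℂ} {a b A : ℝ} (hab : a ≤ b) (hA : 0 ≤ A) (hd : Differentiable ℝ F)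
    (hb : ∀ x, ‖F x‖ ≤ A) (hb' : ∀ x, ‖deriv F x‖ ≤ A)
    (hs : ∀ x, x ∉ Icc a b → F x = 0) (hs' : ∀ x, x ∉ Icc a b → deriv F x = 0) :
    ∫ ξ, ‖𝓕 F ξ‖ ≤ (b - a + 2) * A := by
  rcases hA.eq_or_lt with h0 | hA
  · have : F = 0 := by
      ext x
      simpa [← h0] using hb x
    have h2 : ∀ ξ, 𝓕 F ξ = 0 := by
      intro ξ
      rw [Real.fourier_real_eq]; simp [this]
    simp [h2, ← h0]
  by_cases hi : Integrable (fun ξ => ‖𝓕 F ξ‖)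
  swap
  · rw [integral_undef hi]
    have : 0 ≤ b - a := by linarith
    positivity
  have hm : AEStronglyMeasurable F := hd.continuous.aestronglyMeasurable
  have hm' : AEStronglyMeasurable (deriv F) := (measurable_deriv F).aestronglyMeasurable
  have hFi := auxIntF hm hb hs
  have hFi' := auxIntF hm' hb' hs'
  have hfd := Real.fourier_deriv hFi hd hFi'
  have hc : Continuous (𝓕 F) := by
    have : ContDiff ℝ (0 : ℕ∞) (𝓕 F) := by
      apply Real.contDiff_fourier
      intro n _
      exact auxInt hm hb hs (fun v => ‖v‖ ^ n) (by fun_prop)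
    exact this.continuous
  have hlim := intervalIntegral_tendsto_integral hi tendsto_neg_atTop_atBot (tendsto_id (α := ℝ))
  refine le_of_tendsto hlim ?_
  filter_upwards [eventually_gt_atTop 0] with R hR
  have h1 := auxPlan hab hm hb hs R hR
  have h2 := auxPlan hab hm' hb' hs' R hR
  have hi1 : IntervalIntegrable (fun ξ => ‖𝓕 F ξ‖ ^ 2) volume (-R) R :=
    (by fun_prop : Continuous _).intervalIntegrable _ _
  have hi2 : IntervalIntegrable (fun ξ => ‖𝓕 (deriv F) ξ‖ ^ 2) volume (-R) R := by
    rw [hfd]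
    exact (by fun_prop : Continuous _).intervalIntegrable _ _
  have hi3 : IntervalIntegrable (fun ξ : ℝ => (1 + ξ ^ 2)⁻¹) volume (-R) R :=
    integrable_inv_one_add_sq.intervalIntegrable
  have hpi : ∫ ξ in (-R)..R, (1 + ξ ^ 2)⁻¹ ≤ 4 := by
    rw [intervalIntegral.integral_of_le (by linarith)]
    refine (setIntegral_le_integral integrable_inv_one_add_sq
      (Eventually.of_forall fun x => by simp only [Pi.zero_apply]; positivity)).trans ?_
    rw [integral_univ_inv_one_add_sq]; exact Real.pi_le_four
  have hmain : ∫ ξ in (-R)..R, ‖𝓕 F ξ‖ ≤ ∫ ξ in (-R)..R,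
      ((A⁻¹ / 2) * (‖𝓕 F ξ‖ ^ 2 + ‖𝓕 (deriv F) ξ‖ ^ 2) + (A / 2) * (1 + ξ ^ 2)⁻¹) := by
    refine intervalIntegral.integral_mono_on (by linarith) (hc.norm.intervalIntegrable _ _)
      (((hi1.add hi2).const_mul _).add (hi3.const_mul _)) ?_
    intro ξ _
    have e1 : ‖𝓕 (deriv F) ξ‖ ^ 2 ≥ ξ ^ 2 * ‖𝓕 F ξ‖ ^ 2 := by
      rw [hfd]
      simp only [norm_smul, norm_mul, mul_pow, Complex.norm_real, Complex.norm_I, Complex.norm_ofNat,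
        Real.norm_eq_abs, sq_abs]
      have : (1 : ℝ) ≤ 2 ^ 2 * Real.pi ^ 2 * 1 ^ 2 := by nlinarith [Real.pi_gt_three]
      have h0 : 0 ≤ ξ ^ 2 * ‖𝓕 F ξ‖ ^ 2 := by positivity
      nlinarith
    set z := ‖𝓕 F ξ‖
    have hw : 0 < 1 + ξ ^ 2 := by positivity
    have e2 : (A⁻¹ / 2) * ((1 + ξ ^ 2) * z ^ 2) + (A / 2) * (1 + ξ ^ 2)⁻¹ - z
        = (A⁻¹ / 2) * (1 + ξ ^ 2)⁻¹ * ((1 + ξ ^ 2) * z - A) ^ 2 := by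
      field_simp
      ring
    have e3 : 0 ≤ (A⁻¹ / 2) * (1 + ξ ^ 2)⁻¹ * ((1 + ξ ^ 2) * z - A) ^ 2 := by positivity
    have e4 : (A⁻¹ / 2) * ((1 + ξ ^ 2) * z ^ 2) ≤ (A⁻¹ / 2) * (z ^ 2 + ‖𝓕 (deriv F) ξ‖ ^ 2) := by
      gcongr
      linarith
    linarith
  refine hmain.trans ?_
  rw [intervalIntegral.integral_add ((hi1.add hi2).const_mul _) (hi3.const_mul _),
    intervalIntegral.integral_const_mul, intervalIntegral.integral_const_mul,
    intervalIntegral.integral_add hi1 hi2]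
  calc _ ≤ (A⁻¹ / 2) * (A ^ 2 * (b - a) + A ^ 2 * (b - a)) + (A / 2) * 4 := by gcongr
    _ = _ := by field_simp; ring
def hGau (k : ℕ) : ℝ → ℝ := deriv^[k] (fun y : ℝ => Real.exp (-y ^ 2))

lemma hGau_deriv (k : ℕ) (x : ℝ) : HasDerivAt (hGau k) (hGau (k + 1) x) x := by
  have h : ContDiff ℝ (⊤ : ℕ∞) (hGau k) := ContDiff.iterate_deriv k (by fun_prop)
  have h2 : hGau (k + 1) = deriv (hGau k) := by
    unfold hGau; rw [Function.iterate_succ']; rfl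
  rw [h2]
  exact (h.differentiable (by simp) x).hasDerivAt

lemma hGau_one (x : ℝ) : hGau 1 x = -2 * x * hGau 0 x := by
  have h : HasDerivAt (hGau 0) (-2 * x * hGau 0 x) x := by
    have h1 : HasDerivAt (fun y : ℝ => -y ^ 2) (-2 * x) x := by
      simpa using! ((hasDerivAt_pow 2 x).neg)
    have := h1.exp
    simp only [hGau, Function.iterate_zero, id]
    convert this using 1; ring
  exact (hGau_deriv 0 x).unique h

lemma hGau_rec (k : ℕ) : ∀ x : ℝ, hGau (k + 2) x = -2 * x * hGau (k + 1) x - 2 * (k + 1) * hGau k x := by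
  induction k with
  | zero =>
    intro x
    have h1 : hGau 1 = fun x => -2 * x * hGau 0 x := funext hGau_one
    have h2 : HasDerivAt (hGau 1) (-2 * 1 * hGau 0 x + -2 * x * hGau 1 x) x := by
      have := ((hasDerivAt_id x).const_mul (-2)).mul (hGau_deriv 0 x)
      conv => enter [1]; rw [h1]
      convert! this using 1
    rw [(hGau_deriv 1 x).unique h2]; push_cast; ring
  | succ k ih =>
    intro x
    have h1 : hGau (k + 2) = _ := funext ih
    have h2 : HasDerivAt (hGau (k + 2)) (-2 * 1 * hGau (k + 1) x + -2 * x * hGau (k + 2) x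
        - 2 * (k + 1) * hGau (k + 1) x) x := by
      have := (((hasDerivAt_id x).const_mul (-2)).mul (hGau_deriv (k + 1) x)).sub
        ((hGau_deriv k x).const_mul (2 * ((k : ℝ) + 1)))
      conv => enter [1]; rw [h1]
      exact this
    rw [(hGau_deriv (k + 2) x).unique h2]; push_cast; ring

def hCo (k : ℕ) : ℝ := (Real.sqrt Real.pi * 2 ^ k * (Nat.factorial k : ℝ)) ^ (-(1/2 : ℝ))

lemma hermiteFun_eq (k : ℕ) (x : ℝ) :
    hermiteFun k x = hCo k * (-1) ^ k * Real.exp (x ^ 2 / 2) * hGau k x := rfl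

lemma hCo_rec (k : ℕ) : hCo k = Real.sqrt (2 * (k + 1)) * hCo (k + 1) := by
  unfold hCo
  have h : Real.sqrt Real.pi * 2 ^ (k + 1) * ((k + 1).factorial : ℝ)
      = (2 * (k + 1)) * (Real.sqrt Real.pi * 2 ^ k * (Nat.factorial k : ℝ)) := by
    rw [Nat.factorial_succ]; push_cast; ring
  rw [h, Real.mul_rpow (x := 2 * ((k : ℝ) + 1)) (by positivity) (by positivity), ← mul_assoc,
    Real.sqrt_eq_rpow (2 * ((k : ℝ) + 1)), ← Real.rpow_add (by positivity)]
  simp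

lemma sqrt_mul_self' (k : ℕ) : Real.sqrt (2 * ((k : ℝ) + 1)) * Real.sqrt (2 * (k + 1)) = 2 * (k + 1) :=
  Real.mul_self_sqrt (by positivity)

lemma herm_deriv (k : ℕ) (x : ℝ) :
    HasDerivAt (hermiteFun k) (x * hermiteFun k x - Real.sqrt (2 * (k + 1)) * hermiteFun (k + 1) x) x := by
  have h1 : HasDerivAt (fun y : ℝ => y ^ 2 / 2) x x := by
    have := (hasDerivAt_pow 2 x).div_const 2
    convert! this using 1; simp
  have h2 := (h1.exp.const_mul (hCo k * (-1) ^ k)).mul (hGau_deriv k x)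
  have h3 : hermiteFun k = fun x => hCo k * (-1) ^ k * Real.exp (x ^ 2 / 2) * hGau k x := rfl
  rw [h3]
  convert! h2 using 1
  rw [hermiteFun_eq, hCo_rec k]; ring

lemma herm_rec (k : ℕ) (x : ℝ) :
    Real.sqrt (2 * ((k : ℝ) + 1 + 1)) * hermiteFun (k + 2) x =
      2 * x * hermiteFun (k + 1) x - Real.sqrt (2 * (k + 1)) * hermiteFun k x := by
  have h2 := hCo_rec (k + 1)
  push_cast at h2
  rw [hermiteFun_eq, hermiteFun_eq, hermiteFun_eq, hGau_rec, hCo_rec k, h2]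
  have := sqrt_mul_self' k
  linear_combination ((-1)^k * Real.sqrt (2 * ((k : ℝ) + 1 + 1)) * hCo (k+2) * Real.exp (x ^ 2 / 2) * hGau k x) * this

/-- lowering -/
def hDn (k : ℕ) : ℝ → ℝ := fun x => Real.sqrt (k / 2) * hermiteFun (k - 1) x
def hUp (k : ℕ) : ℝ → ℝ := fun x => Real.sqrt ((k + 1) / 2) * hermiteFun (k + 1) x

lemma sqrt_two_mul (y : ℝ) : Real.sqrt (2 * y) = 2 * Real.sqrt (y / 2) := by
  rw [show 2 * y = 2 ^ 2 * (y / 2) by ring, Real.sqrt_mul (by norm_num), Real.sqrt_sq (by norm_num)]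

lemma herm_X (k : ℕ) (x : ℝ) : x * hermiteFun k x =
    Real.sqrt (k / 2) * hermiteFun (k - 1) x + Real.sqrt ((k + 1) / 2) * hermiteFun (k + 1) x := by
  cases k with
  | zero =>
    have h2 := hCo_rec 0
    rw [sqrt_two_mul] at h2
    have h3 : Real.sqrt ((0 + 1) / 2) * Real.sqrt ((0 + 1) / 2) = 1 / 2 := by
      rw [Real.mul_self_sqrt] <;> norm_num
    simp only [hermiteFun_eq, Nat.cast_zero, zero_div, Real.sqrt_zero, zero_mul, zero_add, hGau_one]
    simp only [Nat.cast_zero, zero_add] at h2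
    rw [h2]; ring
  | succ k =>
    have h := herm_rec k x
    rw [sqrt_two_mul, sqrt_two_mul] at h
    push_cast
    linarith

lemma herm_D (k : ℕ) (x : ℝ) : HasDerivAt (hermiteFun k)
    (Real.sqrt (k / 2) * hermiteFun (k - 1) x - Real.sqrt ((k + 1) / 2) * hermiteFun (k + 1) x) x := by
  have h := herm_deriv k x
  rw [herm_X, sqrt_two_mul] at h
  convert! h using 1
  ring

lemma herm_cont (k : ℕ) : Continuous (hermiteFun k) :=
  continuous_iff_continuousAt.2 fun x => (herm_D k x).continuousAt

lemma herm_zero (x : ℝ) : hermiteFun 0 x = hCo 0 * Real.exp (-(1/2) * x ^ 2) := by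
  rw [hermiteFun_eq]
  simp only [hGau, Function.iterate_zero, id, pow_zero, mul_one]
  rw [mul_assoc, ← Real.exp_add]
  congr 2; ring

lemma abs_mul_exp_le {b c : ℝ} (h : b < c) (x : ℝ) :
    |x| * Real.exp (-c * x ^ 2) ≤ (1 + 1 / (c - b)) * Real.exp (-b * x ^ 2) := by
  have h1 : Real.exp (-b * x ^ 2) = Real.exp ((c - b) * x ^ 2) * Real.exp (-c * x ^ 2) := by
    rw [← Real.exp_add]; congr 1; ring
  have h0 : 0 < c - b := by linarith
  rw [h1, ← mul_assoc]
  gcongr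
  have h2 := Real.add_one_le_exp ((c - b) * x ^ 2)
  calc |x| ≤ 1 + x ^ 2 := by rw [← sq_abs]; nlinarith [abs_nonneg x]
    _ ≤ (1 + 1 / (c - b)) * ((c - b) * x ^ 2 + 1) := by
      have : (1 + 1 / (c - b)) * ((c - b) * x ^ 2 + 1) = (c - b) * x ^ 2 + x ^ 2 + 1 + 1 / (c - b) := by
        field_simp; ring
      have h3 : 0 ≤ 1 / (c - b) := by positivity
      have h4 : 0 ≤ (c - b) * x ^ 2 := by positivity
      linarith
    _ ≤ _ := by gcongr

lemma herm_bd (k : ℕ) : ∀ b : ℝ, b < 1 / 2 → ∃ C, 0 ≤ C ∧ ∀ x, |hermiteFun k x| ≤ C * Real.exp (-b * x ^ 2) := by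
  induction k using Nat.strong_induction_on with
  | _ k ih =>
    intro b hb
    cases k with
    | zero =>
      refine ⟨|hCo 0|, abs_nonneg _, fun x => ?_⟩
      rw [herm_zero, abs_mul, abs_of_nonneg (Real.exp_nonneg _)]
      gcongr
    | succ k =>
      obtain ⟨c, hbc, hc⟩ := exists_between hb
      obtain ⟨C1, hC1, h1⟩ := ih k (by omega) c hc
      obtain ⟨C2, hC2, h2⟩ := ih (k - 1) (by omega) b hb
      have hs : 0 < Real.sqrt (((k : ℝ) + 1) / 2) := Real.sqrt_pos.2 (by positivity)
      have h0 : 0 < c - b := by linarith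
      refine ⟨(C1 * (1 + 1 / (c - b)) + Real.sqrt (k / 2) * C2) / Real.sqrt ((k + 1) / 2), by positivity, fun x => ?_⟩
      have hx := herm_X k x
      have e : hermiteFun (k + 1) x = (x * hermiteFun k x - Real.sqrt (k / 2) * hermiteFun (k - 1) x) / Real.sqrt ((k + 1) / 2) := by
        field_simp; linarith
      rw [e, abs_div, abs_of_pos hs, div_mul_eq_mul_div]
      gcongr
      refine (abs_sub _ _).trans ?_
      rw [abs_mul, abs_mul, abs_of_nonneg (Real.sqrt_nonneg _), add_mul]
      refine add_le_add ?_ ?_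
      · calc |x| * |hermiteFun k x| ≤ |x| * (C1 * Real.exp (-c * x ^ 2)) := by gcongr; exact h1 x
          _ = C1 * (|x| * Real.exp (-c * x ^ 2)) := by ring
          _ ≤ C1 * ((1 + 1 / (c - b)) * Real.exp (-b * x ^ 2)) := by
            exact mul_le_mul_of_nonneg_left (abs_mul_exp_le hbc x) hC1
          _ = _ := by ring
      · rw [mul_assoc]; exact mul_le_mul_of_nonneg_left (h2 x) (Real.sqrt_nonneg _)

lemma herm_bd4 (k : ℕ) : ∃ C, 0 ≤ C ∧ ∀ x, |hermiteFun k x| ≤ C * Real.exp (-(1/4) * x ^ 2) :=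
  herm_bd k (1/4) (by norm_num)

lemma herm_sq_int (j k : ℕ) : Integrable (fun x => hermiteFun j x * hermiteFun k x) := by
  obtain ⟨C, hC, h⟩ := herm_bd4 j
  obtain ⟨D, hD, h'⟩ := herm_bd4 k
  refine ((integrable_exp_neg_mul_sq (b := 1/2) (by norm_num)).const_mul (C * D)).mono'
    ((herm_cont j).mul (herm_cont k)).aestronglyMeasurable (Eventually.of_forall fun x => ?_)
  rw [Real.norm_eq_abs, abs_mul]
  calc _ ≤ (C * Real.exp (-(1/4) * x ^ 2)) * (D * Real.exp (-(1/4) * x ^ 2)) := by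
        gcongr; exacts [h x, h' x]
    _ = (C * D) * (Real.exp (-(1/4) * x ^ 2) * Real.exp (-(1/4) * x ^ 2)) := by ring
    _ = _ := by rw [← Real.exp_add]; congr 2; ring

lemma herm_norm (k : ℕ) : ∫ x, hermiteFun k x ^ 2 = 1 := by
  induction k with
  | zero =>
    simp only [herm_zero, mul_pow, ← Real.exp_nat_mul]
    rw [integral_const_mul]
    have : ∀ x : ℝ, ((2 : ℕ) : ℝ) * (-(1/2) * x ^ 2) = -1 * x ^ 2 := by intro x; push_cast; ring
    simp only [this]
    rw [integral_gaussian]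
    unfold hCo
    simp only [pow_zero, mul_one, Nat.factorial_zero, Nat.cast_one, div_one]
    rw [← Real.rpow_natCast, ← Real.rpow_mul (by positivity)]
    norm_num
    rw [Real.rpow_neg_one]
    field_simp
  | succ k ih =>
    -- derivative of h_k h_{k+1}
    have hd : ∀ x, HasDerivAt (fun x => hermiteFun k x * hermiteFun (k + 1) x)
        (Real.sqrt (2 * (k + 1)) * (hermiteFun k x * hermiteFun k x)
          - Real.sqrt (2 * (k + 1)) * (hermiteFun (k + 1) x * hermiteFun (k + 1) x)) x := by
      intro x
      have h1 := (herm_deriv k x).mul (herm_D (k + 1) x)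
      have h2 := herm_X (k + 1) x
      convert! h1 using 1
      rw [sqrt_two_mul]
      push_cast at h2 ⊢
      linear_combination (-hermiteFun k x) * h2
    have h3 := integral_eq_zero_of_hasDerivAt_of_integrable hd
      (((herm_sq_int k k).const_mul _).sub ((herm_sq_int (k+1) (k+1)).const_mul _)) (herm_sq_int k (k+1))
    rw [integral_sub ((herm_sq_int k k).const_mul _) ((herm_sq_int (k+1) (k+1)).const_mul _),
      integral_const_mul, integral_const_mul] at h3
    simp only [← sq] at h3
    rw [ih] at h3
    have hs : 0 < Real.sqrt (2 * ((k : ℝ) + 1)) := Real.sqrt_pos.2 (by positivity)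
    have : Real.sqrt (2 * ((k : ℝ) + 1)) * (1 - ∫ x, hermiteFun (k + 1) x ^ 2) = 0 := by linarith
    rcases mul_eq_zero.1 this with h | h
    · exact absurd h hs.ne'
    · linarith
def Pf (j k : ℕ) (q y : ℝ) : ℝ := hermiteFun j (y + q / 2) * hermiteFun k (y - q / 2)

def Ef (p y : ℝ) : ℂ := Complex.exp (((p * y : ℝ) : ℂ) * Complex.I)

def Wf (j k : ℕ) (p q : ℝ) : ℂ := ∫ y : ℝ, Ef p y * (Pf j k q y : ℂ)

lemma Ef_norm (p y : ℝ) : ‖Ef p y‖ = 1 := Complex.norm_exp_ofReal_mul_I _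

lemma Ef_cont (p : ℝ) : Continuous (Ef p) := by unfold Ef; fun_prop

lemma Pf_cont (j k : ℕ) (q : ℝ) : Continuous (Pf j k q) := by
  unfold Pf
  exact ((herm_cont j).comp (by fun_prop)).mul ((herm_cont k).comp (by fun_prop))

lemma Pf_bd (j k : ℕ) : ∃ C, 0 ≤ C ∧ ∀ q y, |Pf j k q y| ≤ C * Real.exp (-(1/2) * y ^ 2) := by
  obtain ⟨C, hC, h⟩ := herm_bd4 j
  obtain ⟨D, hD, h'⟩ := herm_bd4 k
  refine ⟨C * D, by positivity, fun q y => ?_⟩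
  unfold Pf
  rw [abs_mul]
  calc _ ≤ (C * Real.exp (-(1/4) * (y + q / 2) ^ 2)) * (D * Real.exp (-(1/4) * (y - q / 2) ^ 2)) := by
        gcongr; exacts [h _, h' _]
    _ = (C * D) * (Real.exp (-(1/4) * (y + q / 2) ^ 2) * Real.exp (-(1/4) * (y - q / 2) ^ 2)) := by ring
    _ ≤ _ := by
      rw [← Real.exp_add]
      gcongr
      nlinarith [sq_nonneg q]

lemma W_int (j k : ℕ) (p q : ℝ) : Integrable (fun y => Ef p y * (Pf j k q y : ℂ)) := by
  obtain ⟨C, hC, h⟩ := Pf_bd j k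
  refine ((integrable_exp_neg_mul_sq (b := 1/2) (by norm_num)).const_mul C).mono'
    ((Ef_cont p).mul (Complex.continuous_ofReal.comp (Pf_cont j k q))).aestronglyMeasurable
    (Eventually.of_forall fun y => ?_)
  rw [norm_mul, Ef_norm, one_mul, Complex.norm_real]
  exact h q y

lemma W_le_one (j k : ℕ) (p q : ℝ) : ‖Wf j k p q‖ ≤ 1 := by
  have hi : ∀ j, Integrable (fun y => hermiteFun j y ^ 2) := fun j => by
    simpa only [sq] using herm_sq_int j j
  have h1 : Integrable (fun y => hermiteFun j (y + q / 2) ^ 2 / 2) :=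
    ((hi j).comp_add_right (q / 2)).div_const 2
  have h2 : Integrable (fun y => hermiteFun k (y - q / 2) ^ 2 / 2) :=
    ((hi k).comp_sub_right (q / 2)).div_const 2
  have h3 : ∫ y, (hermiteFun j (y + q / 2) ^ 2 / 2 + hermiteFun k (y - q / 2) ^ 2 / 2) = 1 := by
    rw [integral_add h1 h2, integral_div, integral_div,
      integral_add_right_eq_self (fun y => hermiteFun j y ^ 2),
      integral_sub_right_eq_self (fun y => hermiteFun k y ^ 2), herm_norm, herm_norm]
    norm_num
  rw [← h3]
  refine norm_integral_le_of_norm_le (h1.add h2) (Eventually.of_forall fun y => ?_)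
  rw [norm_mul, Ef_norm, one_mul, Complex.norm_real, Pf, Real.norm_eq_abs, abs_le]
  constructor <;> nlinarith [sq_nonneg (hermiteFun j (y + q / 2) - hermiteFun k (y - q / 2)),
    sq_nonneg (hermiteFun j (y + q / 2) + hermiteFun k (y - q / 2))]

def Vi (c : Fin 4 → ℂ) (j k : ℕ) (q y : ℝ) : ℂ :=
  c 0 * (Pf (j - 1) k q y : ℂ) + c 1 * (Pf (j + 1) k q y : ℂ) + c 2 * (Pf j (k - 1) q y : ℂ)
    + c 3 * (Pf j (k + 1) q y : ℂ)

def Vf (c : Fin 4 → ℂ) (j k : ℕ) (p q : ℝ) : ℂ :=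
  c 0 * Wf (j - 1) k p q + c 1 * Wf (j + 1) k p q + c 2 * Wf j (k - 1) p q
    + c 3 * Wf j (k + 1) p q

lemma V_expand (c : Fin 4 → ℂ) (j k : ℕ) (p q : ℝ) : (fun y => Ef p y * Vi c j k q y) = fun y =>
    (c 0 * (Ef p y * (Pf (j - 1) k q y : ℂ)) + c 1 * (Ef p y * (Pf (j + 1) k q y : ℂ))
    + c 2 * (Ef p y * (Pf j (k - 1) q y : ℂ))) + c 3 * (Ef p y * (Pf j (k + 1) q y : ℂ)) := by
  ext y; unfold Vi; ring

lemma V_int (c : Fin 4 → ℂ) (j k : ℕ) (p q : ℝ) : Integrable (fun y => Ef p y * Vi c j k q y) := by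
  rw [V_expand]
  exact ((((W_int _ _ p q).const_mul _).add ((W_int _ _ p q).const_mul _)).add
    ((W_int _ _ p q).const_mul _)).add ((W_int _ _ p q).const_mul _)

lemma V_eq (c : Fin 4 → ℂ) (j k : ℕ) (p q : ℝ) :
    ∫ y, Ef p y * Vi c j k q y = Vf c j k p q := by
  have h1 := (W_int (j - 1) k p q).const_mul (c 0)
  have h2 := (W_int (j + 1) k p q).const_mul (c 1)
  have h3 := (W_int j (k - 1) p q).const_mul (c 2)
  have h4 := (W_int j (k + 1) p q).const_mul (c 3)
  have h12 : Integrable (fun y => c 0 * (Ef p y * (Pf (j - 1) k q y : ℂ))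
      + c 1 * (Ef p y * (Pf (j + 1) k q y : ℂ))) := h1.add h2
  have h123 : Integrable (fun y => c 0 * (Ef p y * (Pf (j - 1) k q y : ℂ))
      + c 1 * (Ef p y * (Pf (j + 1) k q y : ℂ)) + c 2 * (Ef p y * (Pf j (k - 1) q y : ℂ))) := h12.add h3
  rw [V_expand, integral_add h123 h4, integral_add h12 h3,
    integral_add h1 h2]
  simp only [integral_const_mul]
  rfl

def ca (k : ℕ) : ℝ := Real.sqrt ((k : ℝ) / 2)
def cb (k : ℕ) : ℝ := Real.sqrt (((k : ℝ) + 1) / 2)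

lemma ca_le {k K : ℕ} (h : k ≤ K) : |ca k| ≤ K + 1 := by
  have : (k : ℝ) ≤ K := by exact_mod_cast h
  have hK : (0 : ℝ) ≤ K := by positivity
  rw [ca, abs_of_nonneg (Real.sqrt_nonneg _)]
  exact Real.sqrt_le_iff.2 ⟨by positivity, by nlinarith⟩

lemma cb_le {k K : ℕ} (h : k ≤ K) : |cb k| ≤ K + 1 := by
  have : (k : ℝ) ≤ K := by exact_mod_cast h
  have hK : (0 : ℝ) ≤ K := by positivity
  rw [cb, abs_of_nonneg (Real.sqrt_nonneg _)]
  exact Real.sqrt_le_iff.2 ⟨by positivity, by nlinarith⟩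

lemma P_q (j k : ℕ) (q y : ℝ) : (q : ℂ) * (Pf j k q y : ℂ) =
    Vi ![ca j, cb j, -ca k, -cb k] j k q y := by
  have h1 := herm_X j (y + q / 2)
  have h2 := herm_X k (y - q / 2)
  have : q * Pf j k q y = ca j * Pf (j - 1) k q y + cb j * Pf (j + 1) k q y
      + -ca k * Pf j (k - 1) q y + -cb k * Pf j (k + 1) q y := by
    unfold Pf ca cb
    linear_combination hermiteFun k (y - q / 2) * h1 - hermiteFun j (y + q / 2) * h2
  simp only [Vi, Matrix.cons_val]
  exact_mod_cast this

lemma P_y (j k : ℕ) (q y : ℝ) : (y : ℂ) * (Pf j k q y : ℂ) =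
    (1 / 2) * Vi ![ca j, cb j, ca k, cb k] j k q y := by
  have h1 := herm_X j (y + q / 2)
  have h2 := herm_X k (y - q / 2)
  have : 2 * y * Pf j k q y = ca j * Pf (j - 1) k q y + cb j * Pf (j + 1) k q y
      + ca k * Pf j (k - 1) q y + cb k * Pf j (k + 1) q y := by
    unfold Pf ca cb
    linear_combination hermiteFun k (y - q / 2) * h1 + hermiteFun j (y + q / 2) * h2
  have h3 : (2 : ℂ) * y * (Pf j k q y : ℂ) = Vi ![ca j, cb j, ca k, cb k] j k q y := by
    simp only [Vi, Matrix.cons_val]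
    exact_mod_cast this
  rw [← h3]; ring

lemma P_dy (j k : ℕ) (q y : ℝ) : HasDerivAt (fun y => (Pf j k q y : ℂ))
    (Vi ![ca j, -cb j, ca k, -cb k] j k q y) y := by
  have h1 := (herm_D j (y + q / 2)).comp_add_const y (q / 2)
  have h2 := (herm_D k (y - q / 2)).comp_sub_const y (q / 2)
  have h3 := (h1.mul h2).ofReal_comp
  convert! h3 using 1
  simp only [Vi, Matrix.cons_val, Pf, ca, cb]
  push_cast; ring

lemma P_dq (j k : ℕ) (q y : ℝ) : HasDerivAt (fun q => (Pf j k q y : ℂ))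
    ((1 / 2) * Vi ![ca j, -cb j, -ca k, cb k] j k q y) q := by
  have e1 : HasDerivAt (fun q : ℝ => y + q / 2) (1 / 2) q :=
    ((hasDerivAt_id q).div_const 2).const_add y
  have e2 : HasDerivAt (fun q : ℝ => y - q / 2) (-(1 / 2)) q :=
    ((hasDerivAt_id q).div_const 2).const_sub y
  have h1 := (herm_D j (y + q / 2)).comp q e1
  have h2 := (herm_D k (y - q / 2)).comp q e2
  have h3 := (h1.mul h2).ofReal_comp
  convert! h3 using 1
  simp only [Vi, Matrix.cons_val, Pf, ca, cb, Function.comp]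
  push_cast; ring

lemma W_q (j k : ℕ) (p q : ℝ) : (q : ℂ) * Wf j k p q = Vf ![ca j, cb j, -ca k, -cb k] j k p q := by
  rw [← V_eq, Wf, ← integral_const_mul]
  congr 1; ext y
  rw [← P_q]; ring

lemma Ef_dy (p y : ℝ) : HasDerivAt (Ef p) (p * Complex.I * Ef p y) y := by
  have h1 : HasDerivAt (fun y : ℝ => p * y) p y := by
    simpa using! (hasDerivAt_id y).const_mul p
  have := (h1.ofReal_comp.mul_const Complex.I).cexp
  convert! this using 1
  rw [mul_comm]; rfl

lemma W_p (j k : ℕ) (p q : ℝ) :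
    (p : ℂ) * Wf j k p q = Complex.I * Vf ![ca j, -cb j, ca k, -cb k] j k p q := by
  have hd : ∀ y, HasDerivAt (fun y => Ef p y * (Pf j k q y : ℂ))
      ((p * Complex.I) * (Ef p y * (Pf j k q y : ℂ)) + Ef p y * Vi ![ca j, -cb j, ca k, -cb k] j k q y) y := by
    intro y
    have := (Ef_dy p y).mul (P_dy j k q y)
    convert! this using 1
    ring
  have h := integral_eq_zero_of_hasDerivAt_of_integrable hd
    (((W_int j k p q).const_mul _).add (V_int _ j k p q)) (W_int j k p q)
  rw [integral_add ((W_int j k p q).const_mul _) (V_int _ j k p q), V_eq, integral_const_mul] at h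
  change p * Complex.I * Wf j k p q + _ = 0 at h
  linear_combination (-Complex.I) * h + (p * Wf j k p q) * Complex.I_mul_I

lemma W_ds (j k : ℕ) (u v s : ℝ) : HasDerivAt (fun s : ℝ => Wf j k (s * u) (s * v))
    ((u : ℂ) * ((Complex.I / 2) * Vf ![ca j, cb j, ca k, cb k] j k (s * u) (s * v))
      + (v : ℂ) * ((1 / 2) * Vf ![ca j, -cb j, -ca k, cb k] j k (s * u) (s * v))) s := by
  set c1 : Fin 4 → ℂ := ![ca j, cb j, ca k, cb k] with hc1
  set c2 : Fin 4 → ℂ := ![ca j, -cb j, -ca k, cb k] with hc2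
  let F' : ℝ → ℝ → ℂ := fun s y => (u * (Complex.I / 2)) * (Ef (s * u) y * Vi c1 j k (s * v) y)
    + (v * (1 / 2)) * (Ef (s * u) y * Vi c2 j k (s * v) y)
  have hVb : ∀ c : Fin 4 → ℂ, ∃ C, 0 ≤ C ∧ ∀ q y, ‖Vi c j k q y‖ ≤ C * Real.exp (-(1/2) * y ^ 2) := by
    intro c
    obtain ⟨C1, hC1, h1⟩ := Pf_bd (j - 1) k
    obtain ⟨C2, hC2, h2⟩ := Pf_bd (j + 1) k
    obtain ⟨C3, hC3, h3⟩ := Pf_bd j (k - 1)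
    obtain ⟨C4, hC4, h4⟩ := Pf_bd j (k + 1)
    refine ⟨‖c 0‖ * C1 + ‖c 1‖ * C2 + ‖c 2‖ * C3 + ‖c 3‖ * C4, by positivity, fun q y => ?_⟩
    unfold Vi
    refine (norm_add₄_le).trans ?_
    simp only [norm_mul, Complex.norm_real, add_mul, mul_assoc, Real.norm_eq_abs]
    have := mul_le_mul_of_nonneg_left (h1 q y) (norm_nonneg (c 0))
    have := mul_le_mul_of_nonneg_left (h2 q y) (norm_nonneg (c 1))
    have := mul_le_mul_of_nonneg_left (h3 q y) (norm_nonneg (c 2))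
    have := mul_le_mul_of_nonneg_left (h4 q y) (norm_nonneg (c 3))
    linarith
  obtain ⟨D1, hD1, hb1⟩ := hVb c1
  obtain ⟨D2, hD2, hb2⟩ := hVb c2
  have hF'i : ∀ s, Integrable (F' s) := fun s =>
    ((V_int c1 j k _ _).const_mul _).add ((V_int c2 j k _ _).const_mul _)
  have key := hasDerivAt_integral_of_dominated_loc_of_deriv_le (μ := volume)
    (F := fun (s : ℝ) y => Ef (s * u) y * (Pf j k (s * v) y : ℂ)) (F' := F') (x₀ := s) (s := univ)
    (bound := fun y => (|u| * (1 / 2) * D1 + |v| * (1 / 2) * D2) * Real.exp (-(1/2) * y ^ 2))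
    univ_mem (Eventually.of_forall fun s => (W_int j k _ _).aestronglyMeasurable)
    (W_int j k _ _) (hF'i s).aestronglyMeasurable ?_ ?_ ?_
  · have h := key.2
    simp only [F'] at h
    rw [integral_add ((V_int c1 j k _ _).const_mul _) ((V_int c2 j k _ _).const_mul _),
      integral_const_mul, integral_const_mul, V_eq, V_eq] at h
    convert! h using 1
    ring
  · refine Eventually.of_forall fun y s _ => ?_
    refine (norm_add_le _ _).trans ?_
    simp only [norm_mul, Ef_norm, one_mul, Complex.norm_real, Real.norm_eq_abs, norm_div, Complex.norm_I, norm_one, Complex.norm_ofNat]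
    rw [add_mul, mul_assoc _ D1, mul_assoc _ D2]
    exact add_le_add (mul_le_mul_of_nonneg_left (hb1 _ y) (by positivity))
      (mul_le_mul_of_nonneg_left (hb2 _ y) (by positivity))
  · exact (integrable_exp_neg_mul_sq (b := 1/2) (by norm_num)).const_mul _
  · refine Eventually.of_forall fun y s _ => ?_
    have e1 : HasDerivAt (fun s : ℝ => Ef (s * u) y) (Ef (s * u) y * (u * y * Complex.I)) s := by
      have h1 : HasDerivAt (fun s : ℝ => s * u * y) (u * y) s := by
        simpa using! ((hasDerivAt_id s).mul_const u).mul_const y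
      have := (h1.ofReal_comp.mul_const Complex.I).cexp
      convert! this using 1
      unfold Ef; push_cast; rfl
    have e2 : HasDerivAt (fun s : ℝ => (Pf j k (s * v) y : ℂ))
        (v • ((1 / 2) * Vi c2 j k (s * v) y)) s := by
      have h0 : HasDerivAt (fun s : ℝ => s * v) v s := by
        simpa using! (hasDerivAt_id s).mul_const v
      exact (P_dq j k (s * v) y).scomp s h0
    have e3 := e1.mul e2
    convert! e3 using 1
    have := P_y j k (s * v) y
    simp only [F', Complex.real_smul]
    linear_combination (-Ef (s * u) y * u * Complex.I) * this

inductive QB (K : ℕ) : ℝ → (ℝ → ℝ → ℂ) → Prop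
  | base (j k : ℕ) (hj : j ≤ K) (hk : k ≤ K) : QB K 1 (Wf j k)
  | smul (a : ℂ) (c : ℝ) (F : ℝ → ℝ → ℂ) (h : QB K c F) : QB K (‖a‖ * c) (fun p q => a * F p q)
  | add (c d : ℝ) (F G : ℝ → ℝ → ℂ) (h : QB K c F) (h' : QB K d G) :
      QB K (c + d) (fun p q => F p q + G p q)
  | mono (c d : ℝ) (F : ℝ → ℝ → ℂ) (h : QB K c F) (h' : c ≤ d) : QB K d F

lemma QB.bound {K c F} (h : QB K c F) (p q : ℝ) : ‖F p q‖ ≤ c := by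
  induction h with
  | base j k hj hk => exact W_le_one j k p q
  | smul a c F h ih => rw [norm_mul]; gcongr
  | add c d F G h h' ih ih' => exact (norm_add_le _ _).trans (add_le_add ih ih')
  | mono c d F h h' ih => exact ih.trans h'

lemma QB.V {K j k : ℕ} (hj : j ≤ K) (hk : k ≤ K) (c : Fin 4 → ℂ) (hc : ∀ i, ‖c i‖ ≤ K + 1) :
    QB (K + 1) (4 * (K + 1)) (Vf c j k) := by
  refine QB.mono _ _ _ (QB.add _ _ _ _ (QB.add _ _ _ _ (QB.add _ _ _ _
    (QB.smul (c 0) _ _ (QB.base (j - 1) k ?_ ?_)) (QB.smul (c 1) _ _ (QB.base (j + 1) k ?_ ?_)))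
    (QB.smul (c 2) _ _ (QB.base j (k - 1) ?_ ?_))) (QB.smul (c 3) _ _ (QB.base j (k + 1) ?_ ?_))) ?_
  any_goals omega
  linarith [hc 0, hc 1, hc 2, hc 3]

lemma cvec_le {K j k : ℕ} (hj : j ≤ K) (hk : k ≤ K) (c : Fin 4 → ℂ)
    (h0 : ‖c 0‖ = |ca j|) (h1 : ‖c 1‖ = |cb j|) (h2 : ‖c 2‖ = |ca k|) (h3 : ‖c 3‖ = |cb k|) :
    ∀ i, ‖c i‖ ≤ K + 1 := by
  intro i
  fin_cases i
  · exact h0.le.trans (ca_le hj)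
  · exact h1.le.trans (cb_le hj)
  · exact h2.le.trans (ca_le hk)
  · exact h3.le.trans (cb_le hk)

lemma QB.mulq {K c F} (h : QB K c F) : QB (K + 1) (4 * (K + 1) * c) (fun p q => (q : ℂ) * F p q) := by
  induction h with
  | base j k hj hk =>
    have : (fun p q : ℝ => (q : ℂ) * Wf j k p q) = Vf ![ca j, cb j, -ca k, -cb k] j k := by
      ext p q; exact W_q j k p q
    rw [this, mul_one]
    exact QB.V hj hk _ (cvec_le hj hk _ (by simp) (by simp) (by simp) (by simp))
  | smul a c F h ih =>
    convert QB.smul a _ _ ih using 1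
    · ring
    · ext p q; ring
  | add c d F G h h' ih ih' =>
    convert QB.add _ _ _ _ ih ih' using 1
    · ring
    · ext p q; ring
  | mono c d F h h' ih => exact QB.mono _ _ _ ih (by gcongr)

lemma QB.mulp {K c F} (h : QB K c F) : QB (K + 1) (4 * (K + 1) * c) (fun p q => (p : ℂ) * F p q) := by
  induction h with
  | base j k hj hk =>
    have : (fun p q : ℝ => (p : ℂ) * Wf j k p q)
        = fun p q => Complex.I * Vf ![ca j, -cb j, ca k, -cb k] j k p q := by
      ext p q; exact W_p j k p q
    rw [this, mul_one]
    refine QB.mono _ _ _ (QB.smul _ _ _ (QB.V hj hk _ (cvec_le hj hk _ (by simp) (by simp) (by simp) (by simp)))) ?_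
    simp
  | smul a c F h ih =>
    convert QB.smul a _ _ ih using 1
    · ring
    · ext p q; ring
  | add c d F G h h' ih ih' =>
    convert QB.add _ _ _ _ ih ih' using 1
    · ring
    · ext p q; ring
  | mono c d F h h' ih => exact QB.mono _ _ _ ih (by gcongr)

lemma QB.weight {K c F} (h : QB K c F) (p q : ℝ) :
    (1 + p ^ 2) * (1 + q ^ 2) * ‖F p q‖ ≤ 289 * ((K : ℝ) + 4) ^ 4 * c := by
  have hc : 0 ≤ c := (norm_nonneg _).trans (h.bound 0 0)
  have h0 := h.bound p q
  have h1 := h.mulp.mulp.bound p q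
  have h2 := h.mulq.mulq.bound p q
  have h3 := h.mulp.mulp.mulq.mulq.bound p q
  simp only [norm_mul, Complex.norm_real, Real.norm_eq_abs] at h1 h2 h3
  push_cast at h1 h2 h3
  have e1 : |p| * (|p| * ‖F p q‖) = p ^ 2 * ‖F p q‖ := by rw [← mul_assoc, abs_mul_abs_self]; ring
  have e2 : |q| * (|q| * ‖F p q‖) = q ^ 2 * ‖F p q‖ := by rw [← mul_assoc, abs_mul_abs_self]; ring
  have e3 : |q| * (|q| * (|p| * (|p| * ‖F p q‖))) = p ^ 2 * q ^ 2 * ‖F p q‖ := by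
    rw [e1, ← mul_assoc, abs_mul_abs_self]; ring
  rw [e1] at h1
  rw [e2] at h2
  rw [e3] at h3
  set X : ℝ := (K : ℝ) + 4 with hX
  have hK : (0 : ℝ) ≤ K := by positivity
  have hX1 : 1 ≤ X := by linarith
  have f1 : 4 * ((K : ℝ) + 1 + 1) * (4 * (K + 1) * c) ≤ 16 * X ^ 2 * c := by
    calc _ ≤ 4 * X * (4 * X * c) := by gcongr <;> linarith
      _ = _ := by ring
  have f3 : 4 * ((K : ℝ) + 1 + 1 + 1 + 1) * (4 * (K + 1 + 1 + 1) * (4 * ((K : ℝ) + 1 + 1) * (4 * (K + 1) * c))) ≤ 256 * X ^ 4 * c := by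
    calc _ ≤ 4 * X * (4 * X * (4 * X * (4 * X * c))) := by gcongr <;> linarith
      _ = _ := by ring
  have g1 : X ^ 2 ≤ X ^ 4 := pow_le_pow_right₀ hX1 (by norm_num)
  have g2 : 1 ≤ X ^ 4 := one_le_pow₀ hX1
  have g3 : X ^ 2 * c ≤ X ^ 4 * c := by gcongr
  have g4 : 1 * c ≤ X ^ 4 * c := by gcongr
  have := h3.trans f3
  have := h1.trans f1
  have := h2.trans f1
  nlinarith

lemma W_final (k : ℕ) (u v s : ℝ) :
    ∃ W' : ℂ, HasDerivAt (fun s : ℝ => Wf k k (s * u) (s * v)) W' s ∧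
      (1 + (s * u) ^ 2) * (1 + (s * v) ^ 2) * ‖Wf k k (s * u) (s * v)‖ ≤ 5000 * ((k : ℝ) + 6) ^ 6 ∧
      |s| * ((1 + (s * u) ^ 2) * (1 + (s * v) ^ 2) * ‖W'‖) ≤ 5000 * ((k : ℝ) + 6) ^ 6 := by
  refine ⟨_, W_ds k k u v s, ?_, ?_⟩
  · refine ((QB.base k k le_rfl le_rfl).weight (s * u) (s * v)).trans ?_
    have : ((k : ℝ) + 4) ^ 4 ≤ (k + 6) ^ 6 := by
      calc ((k : ℝ) + 4) ^ 4 ≤ (k + 6) ^ 4 := by gcongr; norm_num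
        _ ≤ _ := pow_le_pow_right₀ (by have : (0 : ℝ) ≤ k := by positivity
                                       linarith) (by norm_num)
    have h0 : 0 ≤ ((k : ℝ) + 4) ^ 4 := by positivity
    linarith
  · have hA := (QB.smul (Complex.I / 2) _ _ (QB.V (le_refl k) (le_refl k) ![(ca k : ℂ), cb k, ca k, cb k]
      (cvec_le le_rfl le_rfl _ (by simp) (by simp) (by simp) (by simp)))).mulp.weight (s * u) (s * v)
    have hB := (QB.smul (1 / 2) _ _ (QB.V (le_refl k) (le_refl k) ![(ca k : ℂ), -cb k, -ca k, cb k]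
      (cvec_le le_rfl le_rfl _ (by simp) (by simp) (by simp) (by simp)))).mulq.weight (s * u) (s * v)
    set A := Complex.I / 2 * Vf ![(ca k : ℂ), cb k, ca k, cb k] k k (s * u) (s * v)
    set B := 1 / 2 * Vf ![(ca k : ℂ), -cb k, -ca k, cb k] k k (s * u) (s * v)
    set w := (1 + (s * u) ^ 2) * (1 + (s * v) ^ 2)
    have hw : 0 ≤ w := by positivity
    simp only [norm_mul, norm_div, Complex.norm_I, Complex.norm_ofNat, norm_one] at hA hB
    push_cast at hA hB
    have hn : |s| * ‖(u : ℂ) * A + v * B‖ ≤ ‖((s * u : ℝ) : ℂ)‖ * ‖A‖ + ‖((s * v : ℝ) : ℂ)‖ * ‖B‖ := by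
      rw [← norm_mul, ← norm_mul, ← Real.norm_eq_abs, ← Complex.norm_real, ← norm_mul]
      refine le_trans (le_of_eq ?_) (norm_add_le _ _)
      congr 1; push_cast; ring
    have hk0 : (0 : ℝ) ≤ k := by positivity
    have f : 289 * ((k : ℝ) + 1 + 1 + 4) ^ 4 * (4 * (k + 1 + 1) * (1 / 2 * (4 * (k + 1)))) ≤
        2500 * (k + 6) ^ 6 := by
      have e1 : (k : ℝ) + 1 + 1 + 4 = k + 6 := by ring
      have e2 : (k : ℝ) + 1 + 1 ≤ k + 6 := by linarith
      have e3 : (k : ℝ) + 1 ≤ k + 6 := by linarith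
      rw [e1]
      calc _ ≤ 289 * ((k : ℝ) + 6) ^ 4 * (4 * (k + 6) * (1 / 2 * (4 * (k + 6)))) := by
            gcongr 289 * _ * (4 * ?_ * (1 / 2 * (4 * ?_)))
        _ = 2312 * (k + 6) ^ 6 := by ring
        _ ≤ _ := by gcongr; norm_num
    calc |s| * (w * ‖(u : ℂ) * A + v * B‖) = w * (|s| * ‖(u : ℂ) * A + v * B‖) := by ring
      _ ≤ w * (‖((s * u : ℝ) : ℂ)‖ * ‖A‖ + ‖((s * v : ℝ) : ℂ)‖ * ‖B‖) := by gcongr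
      _ ≤ 2500 * (k + 6) ^ 6 + 2500 * (k + 6) ^ 6 := by
        rw [mul_add]
        simp only [Complex.ofReal_mul]
        exact add_le_add (hA.trans f) (hB.trans f)
      _ = _ := by ring
def Gf (n κ : ℕ) (ζ : Fin n → ℂ) (s : ℝ) : ℂ :=
  ∑ k ∈ Finset.Nat.antidiagonalTuple n κ, ∏ j, Wf (k j) (k j) (s * (ζ j).re) (s * (ζ j).im)

lemma W_scale (k : ℕ) (u v s : ℝ) (hs : 0 < s) :
    ∫ x : ℝ, (s : ℂ) * (Complex.exp (((s ^ 2 * (u * x + u * v / 2) : ℝ) : ℂ) * Complex.I) *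
      ((hermiteFun k (s * (x + v)) * hermiteFun k (s * x) : ℝ) : ℂ)) = Wf k k (s * u) (s * v) := by
  let g : ℝ → ℂ := fun y => Complex.exp (((s * u * y + s ^ 2 * u * v / 2 : ℝ) : ℂ) * Complex.I) *
      ((hermiteFun k (y + s * v) * hermiteFun k y : ℝ) : ℂ)
  rw [integral_const_mul]
  have h1 : ∀ x : ℝ, Complex.exp (((s ^ 2 * (u * x + u * v / 2) : ℝ) : ℂ) * Complex.I) *
      ((hermiteFun k (s * (x + v)) * hermiteFun k (s * x) : ℝ) : ℂ) = g (s * x) := by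
    intro x
    simp only [g]
    congr 4
    · ring
    · ring_nf
  simp only [h1]
  rw [Measure.integral_comp_mul_left g s, abs_of_pos (inv_pos.2 hs), Complex.real_smul, ← mul_assoc,
    ← Complex.ofReal_mul, mul_inv_cancel₀ hs.ne', Complex.ofReal_one, one_mul,
    ← integral_sub_right_eq_self g (s * v / 2), Wf]
  congr 1; ext y
  simp only [g, Ef, Pf]
  congr 4
  · ring
  · ring_nf

lemma eKappaLam_eq (n κ : ℕ) (lam : ℝ) (hl : 0 < lam) (w : Hn n) :
    eKappaLam n κ lam w = Complex.exp (((Real.pi * lam * w.2 / 2 : ℝ) : ℂ) * Complex.I) *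
      Gf n κ w.1 (Real.sqrt (2 * Real.pi * lam)) := by
  unfold eKappaLam Gf
  rw [Finset.mul_sum]
  refine Finset.sum_congr rfl fun k _ => ?_
  have hL : 0 < 2 * Real.pi * lam := by positivity
  set s := Real.sqrt (2 * Real.pi * lam) with hs
  have hs0 : 0 < s := Real.sqrt_pos.2 hL
  have hs2 : s ^ 2 = 2 * Real.pi * lam := Real.sq_sqrt hL.le
  have hrp : (2 * Real.pi * |lam|) ^ ((1 : ℝ) / 2) = s := by
    rw [abs_of_pos hl, hs, Real.sqrt_eq_rpow]
  have hrn : (2 * Real.pi * |lam|) ^ ((n : ℝ) / 4) * (2 * Real.pi * |lam|) ^ ((n : ℝ) / 4) = s ^ n := by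
    rw [abs_of_pos hl, ← Real.rpow_add hL, hs, Real.sqrt_eq_rpow, ← Real.rpow_natCast,
      ← Real.rpow_mul hL.le]
    congr 1; ring
  simp only [← fun j => W_scale (k j) (w.1 j).re (w.1 j).im s hs0]
  rw [← integral_fintype_prod_volume_eq_prod (fun (j : Fin n) (x : ℝ) => (s : ℂ) *
    (Complex.exp (((s ^ 2 * ((w.1 j).re * x + (w.1 j).re * (w.1 j).im / 2) : ℝ) : ℂ) * Complex.I) *
      ((hermiteFun (k j) (s * (x + (w.1 j).im)) * hermiteFun (k j) (s * x) : ℝ) : ℂ))),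
    ← integral_const_mul]
  congr 1; ext x
  rw [Finset.prod_mul_distrib, Finset.prod_mul_distrib, ← Complex.exp_sum, Finset.prod_const,
    Finset.card_univ, Fintype.card_fin]
  unfold Rrep hermiteLam hermiteMulti
  rw [hrp, Complex.conj_ofReal]
  have e1 : Complex.exp (2 * Real.pi * Complex.I * (lam : ℂ) *
      (((∑ j, (w.1 j).re * x j) + (∑ j, (w.1 j).re * (w.1 j).im) / 2 + w.2 / 4 : ℝ) : ℂ)) =
      Complex.exp (((Real.pi * lam * w.2 / 2 : ℝ) : ℂ) * Complex.I) *
      Complex.exp (∑ j, ((s ^ 2 * ((w.1 j).re * x j + (w.1 j).re * (w.1 j).im / 2) : ℝ) : ℂ) * Complex.I) := by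
    rw [← Complex.exp_add, ← Finset.sum_mul, ← Complex.ofReal_sum, ← Finset.mul_sum, Finset.sum_add_distrib,
      ← Finset.sum_div, hs2]
    congr 1; push_cast; ring
  rw [e1]
  have e2 : ((s : ℂ)) ^ n = (((2 * Real.pi * |lam|) ^ ((n : ℝ) / 4) * (2 * Real.pi * |lam|) ^ ((n : ℝ) / 4) : ℝ) : ℂ) := by
    rw [hrn]; push_cast; rfl
  rw [e2, ← Complex.ofReal_prod, Finset.prod_mul_distrib]
  push_cast
  ring

def om (n : ℕ) (ζ : Fin n → ℂ) : ℝ := ∏ j, ((1 + (ζ j).re ^ 2)⁻¹ * (1 + (ζ j).im ^ 2)⁻¹)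

lemma om_nonneg (n : ℕ) (ζ : Fin n → ℂ) : 0 ≤ om n ζ := Finset.prod_nonneg fun j _ => by positivity

lemma om_int (n : ℕ) : Integrable (om n) := by
  have h : Integrable (fun z : ℂ => (1 + z.re ^ 2)⁻¹ * (1 + z.im ^ 2)⁻¹) := by
    have h1 : Integrable (fun z : ℝ × ℝ => (1 + z.1 ^ 2)⁻¹ * (1 + z.2 ^ 2)⁻¹) :=
      integrable_inv_one_add_sq.mul_prod integrable_inv_one_add_sq
    exact (Complex.volume_preserving_equiv_real_prod.integrable_comp_emb
      Complex.measurableEquivRealProd.measurableEmbedding).2 h1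
  exact Integrable.fintype_prod (f := fun (_ : Fin n) (z : ℂ) => (1 + z.re ^ 2)⁻¹ * (1 + z.im ^ 2)⁻¹)
    (μ := fun _ => volume) fun _ => h

lemma weight_le {s0 s u : ℝ} (hs0 : 0 < s0) (hs : s0 ≤ s) :
    (1 + (s * u) ^ 2)⁻¹ ≤ (1 + (s0 ^ 2)⁻¹) * (1 + u ^ 2)⁻¹ := by
  rw [← div_eq_mul_inv, le_div_iff₀ (by positivity), inv_mul_le_iff₀ (by positivity)]
  have h1 : s0 ^ 2 ≤ s ^ 2 := by gcongr
  have h2 : (1 + (s * u) ^ 2) * (1 + (s0 ^ 2)⁻¹) ≥ (1 + s0 ^ 2 * u ^ 2) * (1 + (s0 ^ 2)⁻¹) := by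
    rw [mul_pow]
    gcongr
  have h3 : (1 + s0 ^ 2 * u ^ 2) * (1 + (s0 ^ 2)⁻¹) = 1 + u ^ 2 + s0 ^ 2 * u ^ 2 + (s0 ^ 2)⁻¹ := by
    field_simp; ring
  have h4 : 0 ≤ s0 ^ 2 * u ^ 2 + (s0 ^ 2)⁻¹ := by positivity
  linarith

lemma W_unif (s0 : ℝ) (hs0 : 0 < s0) : ∃ D, 0 ≤ D ∧ ∀ (κ k : ℕ), k ≤ κ → ∀ u v s : ℝ, s0 ≤ s →
    ∃ W' : ℂ, HasDerivAt (fun s : ℝ => Wf k k (s * u) (s * v)) W' s ∧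
      ‖Wf k k (s * u) (s * v)‖ ≤ D * (1 + κ : ℝ) ^ 6 * ((1 + u ^ 2)⁻¹ * (1 + v ^ 2)⁻¹) ∧
      ‖W'‖ ≤ D * (1 + κ : ℝ) ^ 6 * ((1 + u ^ 2)⁻¹ * (1 + v ^ 2)⁻¹) := by
  set m := 1 + (s0 ^ 2)⁻¹ with hm
  have hm0 : 0 < m := by positivity
  refine ⟨5000 * 6 ^ 6 * (1 + s0⁻¹) * m ^ 2, by positivity, fun κ k hk u v s hs => ?_⟩
  obtain ⟨W', hd, h1, h2⟩ := W_final k u v s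
  have hs' : 0 < s := hs0.trans_le hs
  have hk' : (k : ℝ) ≤ κ := by exact_mod_cast hk
  have hK : 5000 * ((k : ℝ) + 6) ^ 6 ≤ 5000 * 6 ^ 6 * (1 + κ : ℝ) ^ 6 := by
    rw [mul_assoc, ← mul_pow]
    gcongr
    have : (0 : ℝ) ≤ k := by positivity
    linarith
  set w := (1 + (s * u) ^ 2) * (1 + (s * v) ^ 2) with hw
  have hw0 : 0 < w := by positivity
  have hwi : w⁻¹ ≤ m ^ 2 * ((1 + u ^ 2)⁻¹ * (1 + v ^ 2)⁻¹) := by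
    rw [hw, mul_inv]
    calc _ ≤ (m * (1 + u ^ 2)⁻¹) * (m * (1 + v ^ 2)⁻¹) := by
          gcongr
          · exact weight_le hs0 hs
          · exact weight_le hs0 hs
      _ = _ := by ring
  set o := (1 + u ^ 2)⁻¹ * (1 + v ^ 2)⁻¹
  have ho : 0 ≤ o := by positivity
  have hsi : s⁻¹ ≤ s0⁻¹ := by gcongr
  have hsi0 : 0 < s0⁻¹ := by positivity
  refine ⟨W', hd, ?_, ?_⟩
  · calc ‖Wf k k (s * u) (s * v)‖ = w⁻¹ * (w * ‖Wf k k (s * u) (s * v)‖) := by field_simp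
      _ ≤ (m ^ 2 * o) * (5000 * 6 ^ 6 * (1 + κ : ℝ) ^ 6) := by
        exact mul_le_mul hwi (h1.trans hK) (by positivity) (by positivity)
      _ = (5000 * 6 ^ 6 * 1 * m ^ 2 * (1 + κ : ℝ) ^ 6 * o) := by ring
      _ ≤ _ := by gcongr; linarith
  · rw [abs_of_pos hs'] at h2
    calc ‖W'‖ = s⁻¹ * (w⁻¹ * (s * (w * ‖W'‖))) := by field_simp
      _ ≤ (1 + s0⁻¹) * ((m ^ 2 * o) * (5000 * 6 ^ 6 * (1 + κ : ℝ) ^ 6)) := by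
        exact mul_le_mul (by linarith) (mul_le_mul hwi (h2.trans hK) (by positivity) (by positivity)) (by positivity) (by positivity)
      _ = _ := by ring

lemma card_adt (n κ : ℕ) : (Finset.Nat.antidiagonalTuple n κ).card ≤ (κ + 1) ^ n := by
  have : Finset.Nat.antidiagonalTuple n κ ⊆ Fintype.piFinset (fun _ : Fin n => Finset.range (κ + 1)) := by
    intro k hk
    rw [Finset.Nat.mem_antidiagonalTuple] at hk
    rw [Fintype.mem_piFinset]
    intro j
    have : k j ≤ ∑ i, k i := Finset.single_le_sum (f := k) (fun _ _ => Nat.zero_le _) (Finset.mem_univ j)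
    rw [Finset.mem_range]; omega
  refine (Finset.card_le_card this).trans ?_
  simp

lemma G_unif (n : ℕ) (s0 : ℝ) (hs0 : 0 < s0) : ∃ D, 0 ≤ D ∧ ∀ (κ : ℕ) (ζ : Fin n → ℂ) (s : ℝ), s0 ≤ s →
    ∃ G' : ℂ, HasDerivAt (Gf n κ ζ) G' s ∧
      ‖Gf n κ ζ s‖ ≤ D * (1 + κ : ℝ) ^ (7 * n) * om n ζ ∧
      ‖G'‖ ≤ D * (1 + κ : ℝ) ^ (7 * n) * om n ζ := by
  obtain ⟨D, hD, h⟩ := W_unif s0 hs0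
  refine ⟨D ^ n * (n + 1), by positivity, fun κ ζ s hs => ?_⟩
  choose! W' hd h1 h2 using fun k hk u v => h κ k hk u v s hs
  have hkj : ∀ k ∈ Finset.Nat.antidiagonalTuple n κ, ∀ j, k j ≤ κ := by
    intro k hk j
    rw [Finset.Nat.mem_antidiagonalTuple] at hk
    have : k j ≤ ∑ i, k i := Finset.single_le_sum (f := k) (fun _ _ => Nat.zero_le _) (Finset.mem_univ j)
    omega
  have hcard : ((Finset.Nat.antidiagonalTuple n κ).card : ℝ) ≤ (1 + κ : ℝ) ^ n := by
    have := card_adt n κ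
    rw [add_comm]
    exact_mod_cast this
  have ho := om_nonneg n ζ
  let T : Fin n → ℝ := fun j => D * (1 + κ : ℝ) ^ 6 * ((1 + (ζ j).re ^ 2)⁻¹ * (1 + (ζ j).im ^ 2)⁻¹)
  have hT : ∀ j, 0 ≤ T j := fun j => by positivity
  have hprod : ∏ j, T j = D ^ n * (1 + κ : ℝ) ^ (6 * n) * om n ζ := by
    simp only [T, om]
    rw [Finset.prod_mul_distrib, Finset.prod_const, Finset.card_univ, Fintype.card_fin, mul_pow, ← pow_mul]
  have hfin : ∀ c : ℝ, 0 ≤ c → c ≤ n + 1 → ∀ f : (Fin n → ℕ) → ℂ,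
      (∀ k ∈ Finset.Nat.antidiagonalTuple n κ, ‖f k‖ ≤ c * ∏ j, T j) →
      ‖∑ k ∈ Finset.Nat.antidiagonalTuple n κ, f k‖ ≤ D ^ n * (n + 1) * (1 + κ : ℝ) ^ (7 * n) * om n ζ := by
    intro c hc0 hc f hf
    refine (norm_sum_le_of_le _ hf).trans ?_
    rw [Finset.sum_const, nsmul_eq_mul, hprod]
    have hpos : 0 ≤ c * (D ^ n * (1 + κ : ℝ) ^ (6 * n) * om n ζ) := by positivity
    calc _ ≤ (1 + κ : ℝ) ^ n * ((n + 1) * (D ^ n * (1 + κ : ℝ) ^ (6 * n) * om n ζ)) := by gcongr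
      _ = D ^ n * (n + 1) * ((1 + κ : ℝ) ^ n * (1 + κ : ℝ) ^ (6 * n)) * om n ζ := by ring
      _ = _ := by rw [← pow_add]; congr 3; ring
  refine ⟨_, HasDerivAt.fun_sum fun k hk => HasDerivAt.fun_finsetProd fun j _ =>
    hd (k j) (hkj k hk j) (ζ j).re (ζ j).im, ?_, ?_⟩
  · refine hfin 1 (by norm_num) (by linarith [Nat.cast_nonneg (α := ℝ) n]) _ fun k hk => ?_
    rw [one_mul, norm_prod]
    exact Finset.prod_le_prod (fun _ _ => norm_nonneg _) fun j _ => h1 _ (hkj k hk j) _ _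
  · refine hfin n (by positivity) (by linarith) _ fun k hk => ?_
    refine (norm_sum_le_of_le (f := _) (n := fun _ => ∏ j, T j) _ fun i _ => ?_).trans (le_of_eq (by simp))
    rw [smul_eq_mul, norm_mul, norm_prod, ← Finset.prod_erase_mul _ _ (Finset.mem_univ i)]
    refine mul_le_mul ?_ (h2 _ (hkj k hk i) _ _) (norm_nonneg _) (Finset.prod_nonneg fun j _ => hT j)
    exact Finset.prod_le_prod (fun _ _ => norm_nonneg _) fun j _ => h1 _ (hkj k hk j) _ _

def Ff (n κ : ℕ) (ψ : ℝ → ℝ) (ζ : Fin n → ℂ) (lam : ℝ) : ℂ :=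
  Gf n κ ζ (Real.sqrt (2 * Real.pi * lam)) * (ψ lam : ℂ)

lemma eKappaPsi_eq (n κ : ℕ) (ψ : ℝ → ℝ) (hψ : ∀ lam, lam ≤ 0 → ψ lam = 0) (ζ : Fin n → ℂ) (t : ℝ) :
    eKappaPsi n κ ψ (ζ, t) = 𝓕 (Ff n κ ψ ζ) ((-1 / 4) * t) := by
  rw [Real.fourier_eq']
  unfold eKappaPsi
  congr 1; ext lam
  rcases le_or_gt lam 0 with hl | hl
  · simp [Ff, hψ lam hl]
  · rw [eKappaLam_eq n κ lam hl, Ff, smul_eq_mul, mul_assoc]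
    congr 3
    simp
    ring

lemma F_facts (n κ : ℕ) (ε : ℝ) (hε0 : 0 < ε) (s0 : ℝ)
    (hs : s0 = Real.sqrt (2 * Real.pi * ε)) (ψ : ℝ → ℝ)
    (hψ : ContDiff ℝ (⊤ : ℕ∞) ψ) (hsup : tsupport ψ ⊆ Set.Icc ε ε⁻¹) (B₁ B₂ : ℝ)
    (hB1 : ∀ lam : ℝ, |ψ lam| ≤ B₁) (hB2 : ∀ lam : ℝ, |deriv ψ lam| ≤ B₂) (ζ : Fin n → ℂ) (N : ℝ)
    (hN : 0 ≤ N)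
    (hG : ∀ s : ℝ, s0 ≤ s → ∃ G' : ℂ, HasDerivAt (Gf n κ ζ) G' s ∧ ‖Gf n κ ζ s‖ ≤ N ∧ ‖G'‖ ≤ N) (lam : ℝ) :
    ∃ F', HasDerivAt (Ff n κ ψ ζ) F' lam ∧ ‖Ff n κ ψ ζ lam‖ ≤ (1 + Real.pi / s0) * N * (B₁ + B₂) ∧
      ‖F'‖ ≤ (1 + Real.pi / s0) * N * (B₁ + B₂) ∧ (lam ∉ Icc ε ε⁻¹ → Ff n κ ψ ζ lam = 0 ∧ F' = 0) := by
  have hB1' : 0 ≤ B₁ := (abs_nonneg _).trans (hB1 0)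
  have hB2' : 0 ≤ B₂ := (abs_nonneg _).trans (hB2 0)
  have hs0 : 0 < s0 := by rw [hs]; exact Real.sqrt_pos.2 (by positivity)
  by_cases hl : lam ∈ tsupport ψ
  · have hI := hsup hl
    have hlp : 0 < lam := hε0.trans_le hI.1
    set s := Real.sqrt (2 * Real.pi * lam) with hsd
    have hss : s0 ≤ s := by
      rw [hs, hsd]
      apply Real.sqrt_le_sqrt
      have := hI.1
      gcongr
    have hsp := hs0.trans_le hss
    obtain ⟨G', hd, h1, h2⟩ := hG s hss
    have hds : HasDerivAt (fun l : ℝ => Real.sqrt (2 * Real.pi * l)) (Real.pi / s) lam := by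
      have h0 : HasDerivAt (fun l : ℝ => 2 * Real.pi * l) (2 * Real.pi) lam := by
        simpa using! (hasDerivAt_id lam).const_mul (2 * Real.pi)
      have := h0.sqrt (by positivity)
      convert this using 1
      rw [← hsd]; field_simp
    have hdψ : HasDerivAt (fun l => (ψ l : ℂ)) ((deriv ψ lam : ℝ) : ℂ) lam :=
      (hψ.differentiable (by simp) lam).hasDerivAt.ofReal_comp
    have hdF := (hd.scomp lam hds).mul hdψ
    refine ⟨_, hdF, ?_, ?_, fun h => absurd hI h⟩
    · rw [Ff, norm_mul, Complex.norm_real, Real.norm_eq_abs]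
      calc _ ≤ N * B₁ := by gcongr; exact hB1 _
        _ = 1 * N * (B₁ + 0) := by ring
        _ ≤ _ := by
          gcongr
          have : 0 ≤ Real.pi / s0 := by positivity
          linarith
    · refine (norm_add_le _ _).trans ?_
      simp only [norm_mul, norm_smul, Complex.norm_real, Real.norm_eq_abs, Function.comp]
      have hps : |Real.pi / s| ≤ Real.pi / s0 := by
        rw [abs_of_nonneg (by positivity)]; gcongr
      have hp0 : 0 ≤ Real.pi / s0 := by positivity
      calc _ ≤ (Real.pi / s0) * N * B₁ + N * B₂ := by
            gcongr
            · exact hB1 _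
            · exact hB2 _
        _ ≤ _ := by
          have e1 : 0 ≤ N * B₁ := by positivity
          have e2 : 0 ≤ (Real.pi / s0) * N * B₂ := by positivity
          linarith
  · have h0 : Ff n κ ψ ζ =ᶠ[𝓝 lam] fun _ => 0 := by
      have := notMem_tsupport_iff_eventuallyEq.1 hl
      filter_upwards [this] with l hl
      simp [Ff, hl]
    have hd : HasDerivAt (Ff n κ ψ ζ) 0 lam := (hasDerivAt_const lam (0 : ℂ)).congr_of_eventuallyEq h0
    have hz : Ff n κ ψ ζ lam = 0 := h0.self_of_nhds
    refine ⟨0, hd, ?_, ?_, fun _ => ⟨hz, rfl⟩⟩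
    · rw [hz, norm_zero]; positivity
    · rw [norm_zero]; positivity

/-- There exist `C, M > 0` such that for every `ψ ∈ C_c^∞(ℝ)` supported in
`[ε, ε⁻¹]` and every `κ ∈ ℕ`, `‖e_κ^ψ‖_{L¹(H^n)} ≤ C (1+κ)^M (‖ψ‖_∞ + ‖ψ'‖_∞)`. -/
theorem stmt19 (n : ℕ) (hn : 1 ≤ n) (ε : ℝ) (hε0 : 0 < ε) (hε1 : ε < 1) :
    ∃ C : ℝ, 0 < C ∧ ∃ M : ℝ, 0 < M ∧
      ∀ ψ : ℝ → ℝ, ContDiff ℝ (⊤ : ℕ∞) ψ → HasCompactSupport ψ →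
        tsupport ψ ⊆ Set.Icc ε ε⁻¹ →
        ∀ κ : ℕ, ∀ B₁ B₂ : ℝ,
          (∀ lam : ℝ, |ψ lam| ≤ B₁) → (∀ lam : ℝ, |deriv ψ lam| ≤ B₂) →
          ∫ w : Hn n, ‖eKappaPsi n κ ψ w‖ ≤ C * ((1 + κ : ℝ)) ^ M * (B₁ + B₂) := by
  obtain ⟨s0, hs0⟩ : ∃ s0, s0 = Real.sqrt (2 * Real.pi * ε) := ⟨_, rfl⟩
  have hs0p : 0 < s0 := by rw [hs0]; exact Real.sqrt_pos.2 (by positivity)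
  obtain ⟨D, hD, hG⟩ := G_unif n s0 hs0p
  have hεi : ε ≤ ε⁻¹ := by
    have : 1 < ε⁻¹ := (one_lt_inv₀ hε0).2 hε1
    linarith
  have hOm : 0 ≤ ∫ ζ, om n ζ := integral_nonneg (om_nonneg n)
  have hL : 0 < ε⁻¹ - ε + 2 := by linarith
  have hP : 0 < 1 + Real.pi / s0 := by positivity
  refine ⟨4 * (ε⁻¹ - ε + 2) * (1 + Real.pi / s0) * D * (∫ ζ, om n ζ) + 1, by positivity,
    ((7 * n : ℕ) : ℝ), by exact_mod_cast (by omega : 0 < 7 * n), ?_⟩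
  intro ψ hψ _ hsup κ B₁ B₂ hB1 hB2
  have hB1' : 0 ≤ B₁ := (abs_nonneg _).trans (hB1 0)
  have hB2' : 0 ≤ B₂ := (abs_nonneg _).trans (hB2 0)
  rw [Real.rpow_natCast]
  have hψ0 : ∀ lam, lam ≤ 0 → ψ lam = 0 := by
    intro lam hl
    by_contra h
    have := (hsup (subset_tsupport ψ h)).1
    linarith
  by_cases hi : Integrable (fun w : Hn n => ‖eKappaPsi n κ ψ w‖)
  swap
  · rw [integral_undef hi]; positivity
  set X : ℝ := (1 + κ : ℝ) ^ (7 * n) with hX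
  have hX0 : 0 ≤ X := by positivity
  have hslice : ∀ ζ : Fin n → ℂ, ∫ t, ‖eKappaPsi n κ ψ (ζ, t)‖ ≤
      (4 * (ε⁻¹ - ε + 2) * (1 + Real.pi / s0) * D * X * (B₁ + B₂)) * om n ζ := by
    intro ζ
    have ho := om_nonneg n ζ
    simp only [eKappaPsi_eq n κ ψ hψ0 ζ]
    rw [Measure.integral_comp_mul_left (fun ξ => ‖𝓕 (Ff n κ ψ ζ) ξ‖)]
    have hF := F_facts n κ ε hε0 s0 hs0 ψ hψ hsup B₁ B₂ hB1 hB2 ζ (D * X * om n ζ) (by positivity)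
      (hG κ ζ)
    choose F' hd hb hb' hz using hF
    have hder : deriv (Ff n κ ψ ζ) = F' := funext fun x => (hd x).deriv
    have := auxL1 (F := Ff n κ ψ ζ) (A := (1 + Real.pi / s0) * (D * X * om n ζ) * (B₁ + B₂)) hεi
      (by positivity) (fun x => (hd x).differentiableAt) hb (by rw [hder]; exact hb')
      (fun x hx => (hz x hx).1) (fun x hx => by rw [hder]; exact (hz x hx).2)
    have h4 : |((-1 : ℝ) / 4)⁻¹| = 4 := by norm_num [abs_of_neg]
    rw [h4, smul_eq_mul]
    calc _ ≤ 4 * _ := mul_le_mul_of_nonneg_left this (by norm_num)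
      _ = _ := by ring
  have hi' : Integrable (fun w : Hn n => ‖eKappaPsi n κ ψ w‖) (volume.prod volume) := hi
  have hprod : ∫ w : Hn n, ‖eKappaPsi n κ ψ w‖ = ∫ ζ, ∫ t, ‖eKappaPsi n κ ψ (ζ, t)‖ :=
    integral_prod _ hi'
  rw [hprod]
  calc _ ≤ ∫ ζ, (4 * (ε⁻¹ - ε + 2) * (1 + Real.pi / s0) * D * X * (B₁ + B₂)) * om n ζ :=
        integral_mono_of_nonneg
          (Eventually.of_forall fun ζ => integral_nonneg fun t => norm_nonneg _)
          ((om_int n).const_mul _) (Eventually.of_forall hslice)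
    _ = (4 * (ε⁻¹ - ε + 2) * (1 + Real.pi / s0) * D * (∫ ζ, om n ζ) + 0) * X * (B₁ + B₂) := by
        rw [integral_const_mul]; ring
    _ ≤ _ := by gcongr; norm_num
end
end
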